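/- arXiv:2007.10832 — 2 statements merged into one kernel-verified Lean document; each statement's English description precedes it below -/
import Mathlib

section
/- Let H be an ordered graph on h vertices with at least one edge. There exists η₀>0 (depending on h) such that for every η with 0<η≤η₀ there exist n₀∈ℕ and ξ>0 with the following property. Set s := ⌈32/η⌉. Let G be an ordered graph on vertex set [n] with n ≥ n₀ and minimum degree δ(G) ≥ (1 − 1/χ<(H) + η)n. Then for every pair x,y ∈ [n] there are at least ξn^{sh−1} sets X ⊆ [n]∖{x,y} of size sh−1 such that both G[X∪{x}] and G[X∪{y}] contain perfect H-tilings. -/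
open Finset

section Defs

variable {h n : ℕ}

/-- `φ` is an order-preserving embedding of the ordered graph `H` into the ordered graph `G`:
a strictly increasing map carrying edges of `H` to edges of `G`. -/
def IsOrderedCopy (H : SimpleGraph (Fin h)) (G : SimpleGraph (Fin n))
    (φ : Fin h → Fin n) : Prop :=
  StrictMono φ ∧ ∀ i j : Fin h, H.Adj i j → G.Adj (φ i) (φ j)

/-- `S` is the vertex set of a copy of the ordered graph `H` in the ordered graph `G`. -/
def IsCopySet (H : SimpleGraph (Fin h)) (G : SimpleGraph (Fin n))
    (S : Finset (Fin n)) : Prop :=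
  ∃ φ : Fin h → Fin n, IsOrderedCopy H G φ ∧ Finset.image φ Finset.univ = S

/-- `G` has an `H`-tiling (vertex-disjoint copies of `H`) whose copies exactly cover the
vertex set `S`; equivalently, the induced ordered subgraph `G[S]` has a perfect `H`-tiling. -/
def HasPerfectTilingOn (H : SimpleGraph (Fin h)) (G : SimpleGraph (Fin n))
    (S : Finset (Fin n)) : Prop :=
  ∃ 𝒯 : Finset (Finset (Fin n)),
    (∀ T ∈ 𝒯, IsCopySet H G T) ∧
    (𝒯 : Set (Finset (Fin n))).PairwiseDisjoint id ∧
    𝒯.biUnion id = S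

/-- `G` has a perfect `H`-tiling. -/
def HasPerfectTiling (H : SimpleGraph (Fin h)) (G : SimpleGraph (Fin n)) : Prop :=
  HasPerfectTilingOn H G Finset.univ

/-- The degree of a vertex in an ordered graph. -/
noncomputable def odeg (G : SimpleGraph (Fin n)) (v : Fin n) : ℕ :=
  (G.neighborSet v).ncard

/-- `[h]` can be partitioned into `k` intervals, each independent in `H`
(expressed via a monotone colouring with independent fibres). -/
def HasIntervalColoring (H : SimpleGraph (Fin h)) (k : ℕ) : Prop :=
  ∃ c : Fin h → Fin k, Monotone c ∧ ∀ i j : Fin h, H.Adj i j → c i ≠ c j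

/-- The interval chromatic number `χ<(H)` of an ordered graph. -/
noncomputable def intervalChi (H : SimpleGraph (Fin h)) : ℕ :=
  sInf {k | HasIntervalColoring H k}

/-- `α⁺ᵢ(H)`: `α⁺₀ = 0`, and `α⁺_{i+1}` is the largest `k ≤ h` such that the interval
`[α⁺ᵢ + 1, k]` is independent in `H` (vertices are 1-indexed via `v ↦ (v : ℕ) + 1`). -/
noncomputable def alphaPlus (H : SimpleGraph (Fin h)) : ℕ → ℕ
  | 0 => 0
  | (i + 1) => sSup {k | k ≤ h ∧ ∀ a b : Fin h,
      alphaPlus H i + 1 ≤ (a : ℕ) + 1 → (a : ℕ) + 1 ≤ k →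
      alphaPlus H i + 1 ≤ (b : ℕ) + 1 → (b : ℕ) + 1 ≤ k → ¬ H.Adj a b}

/-- `α⁻ᵢ(H)`: `α⁻₀ = h + 1`, and `α⁻_{i+1}` is the smallest `k ≥ 1` such that the interval
`[k, α⁻ᵢ − 1]` is independent in `H`. -/
noncomputable def alphaMinus (H : SimpleGraph (Fin h)) : ℕ → ℕ
  | 0 => h + 1
  | (i + 1) => sInf {k | 1 ≤ k ∧ ∀ a b : Fin h,
      k ≤ (a : ℕ) + 1 → (a : ℕ) + 1 ≤ alphaMinus H i - 1 →
      k ≤ (b : ℕ) + 1 → (b : ℕ) + 1 ≤ alphaMinus H i - 1 → ¬ H.Adj a b}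

/-- `α*(H) = min over 1 ≤ ℓ < χ<(H) of min{α⁺_ℓ/(ℓh), (h − α⁻_ℓ + 1)/(ℓh)}`. -/
noncomputable def alphaStar (H : SimpleGraph (Fin h)) : ℝ :=
  sInf {x : ℝ | ∃ ℓ : ℕ, 1 ≤ ℓ ∧ ℓ < intervalChi H ∧
    (x = (alphaPlus H ℓ : ℝ) / (ℓ * h) ∨
     x = ((h : ℝ) - alphaMinus H ℓ + 1) / (ℓ * h))}

/-- `α*(H)` for ordered graphs with interval chromatic number 2:
`min{α⁺₁(H)/h, (h − α⁻₁(H) + 1)/h}`. -/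
noncomputable def alphaStar2 (H : SimpleGraph (Fin h)) : ℝ :=
  min ((alphaPlus H 1 : ℝ) / h) (((h : ℝ) - alphaMinus H 1 + 1) / h)

/-- Property A: no edges of `H` within `[1, ⌊h/2⌋ + 1]` nor within `[⌈h/2⌉, h]`. -/
def PropertyA (H : SimpleGraph (Fin h)) : Prop :=
  (∀ a b : Fin h, (a : ℕ) + 1 ≤ h / 2 + 1 → (b : ℕ) + 1 ≤ h / 2 + 1 → ¬ H.Adj a b) ∧
  (∀ a b : Fin h, (h + 1) / 2 ≤ (a : ℕ) + 1 → (h + 1) / 2 ≤ (b : ℕ) + 1 → ¬ H.Adj a b)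

/-- Property B: for each partition of `[h]` into nonempty intervals `[1, i], [i+1, h]`
there is an edge of `H` between them. -/
def PropertyB (H : SimpleGraph (Fin h)) : Prop :=
  ∀ i : ℕ, 1 ≤ i → i < h →
    ∃ a b : Fin h, H.Adj a b ∧ (a : ℕ) + 1 ≤ i ∧ i + 1 ≤ (b : ℕ) + 1

/-- `s(H)`: the smallest vertex adjacent to `h`, and `0` if `h` is isolated. -/
noncomputable def sOG (H : SimpleGraph (Fin h)) : ℕ :=
  sInf {k | ∃ a b : Fin h, H.Adj a b ∧ (a : ℕ) + 1 = k ∧ (b : ℕ) + 1 = h}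

open Classical in
/-- `l(H)`: the largest vertex adjacent to `1`, and `h + 1` if `1` is isolated. -/
noncomputable def lOG (H : SimpleGraph (Fin h)) : ℕ :=
  if ∃ a b : Fin h, H.Adj a b ∧ (a : ℕ) + 1 = 1 then
    sSup {k | ∃ a b : Fin h, H.Adj a b ∧ (a : ℕ) + 1 = 1 ∧ (b : ℕ) + 1 = k}
  else h + 1

/-- The vertex `h` has Property C: `s(H) ≥ 1` and there is an edge within `[s(H), h − 1]`. -/
def PropertyCLast (H : SimpleGraph (Fin h)) : Prop :=
  1 ≤ sOG H ∧ ∃ a b : Fin h, H.Adj a b ∧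
    sOG H ≤ (a : ℕ) + 1 ∧ (a : ℕ) + 1 ≤ h - 1 ∧
    sOG H ≤ (b : ℕ) + 1 ∧ (b : ℕ) + 1 ≤ h - 1

/-- The vertex `1` has Property C: `l(H) ≤ h` and there is an edge within `[2, l(H)]`. -/
def PropertyCFirst (H : SimpleGraph (Fin h)) : Prop :=
  lOG H ≤ h ∧ ∃ a b : Fin h, H.Adj a b ∧
    2 ≤ (a : ℕ) + 1 ∧ (a : ℕ) + 1 ≤ lOG H ∧
    2 ≤ (b : ℕ) + 1 ∧ (b : ℕ) + 1 ≤ lOG H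

/-- `S` is an `H`-absorbing set for `W`: both `G[S]` and `G[S ∪ W]` have perfect `H`-tilings. -/
def IsAbsorbingFor (H : SimpleGraph (Fin h)) (G : SimpleGraph (Fin n))
    (S W : Finset (Fin n)) : Prop :=
  HasPerfectTilingOn H G S ∧ HasPerfectTilingOn H G (S ∪ W)

end Defs

section Regularity

/-- The density `d(A,B) = e(A,B)/(|A||B|)` of a pair of vertex sets in a graph. -/
noncomputable def pairDensity {V : Type*} (G : SimpleGraph V) (A B : Finset V) : ℝ :=
  ({e : V × V | e.1 ∈ A ∧ e.2 ∈ B ∧ G.Adj e.1 e.2}.ncard : ℝ) /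
    ((A.card : ℝ) * (B.card : ℝ))

/-- The pair `(A, B)` is `ε`-regular in `G`. -/
def IsRegularPair {V : Type*} (G : SimpleGraph V) (A B : Finset V) (ε : ℝ) : Prop :=
  ∀ X ⊆ A, ∀ Y ⊆ B, ε * A.card ≤ (X.card : ℝ) → ε * B.card ≤ (Y.card : ℝ) →
    |pairDensity G A B - pairDensity G X Y| < ε

end Regularity

section Bottle

/-- The chromatic number of a finite graph. -/
noncomputable def chromNum {m : ℕ} (B : SimpleGraph (Fin m)) : ℕ :=
  sInf {k | ∃ c : Fin m → Fin k, ∀ x y : Fin m, B.Adj x y → c x ≠ c y}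

/-- `σ(B)`: the smallest size of a colour class in any proper colouring of `B`
with `χ(B)` colours. -/
noncomputable def sigmaMinCl {m : ℕ} (B : SimpleGraph (Fin m)) : ℕ :=
  sInf {c | ∃ C : Fin m → Fin (chromNum B),
    (∀ x y : Fin m, B.Adj x y → C x ≠ C y) ∧
    ∃ i : Fin (chromNum B), c = (Finset.univ.filter (fun v => C v = i)).card}

/-- The critical chromatic number `χ_cr(B) = (χ(B) − 1)·|B|/(|B| − σ(B))`. -/
noncomputable def critChrom {m : ℕ} (B : SimpleGraph (Fin m)) : ℝ :=
  ((chromNum B : ℝ) - 1) * m / ((m : ℝ) - sigmaMinCl B)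

/-- `φ` is an interval labeling of the complete multipartite graph with part function `p`
(with respect to some permutation `σ` of the parts). -/
def IsIntervalLabeling {m k : ℕ} (p : Fin m → Fin k) (φ : Equiv.Perm (Fin m)) : Prop :=
  ∃ σ : Equiv.Perm (Fin k), ∀ x y : Fin m, σ (p x) < σ (p y) → φ x < φ y

/-- `G` is (an isomorphic realisation of) the ordered blow-up `(B(t), φ)` of the complete
multipartite graph `B` with part function `p`: there is a block assignment `β` whose fibres
all have size `t`, compatible with the order induced by `φ`, with adjacency between blocks
given by `B`. -/
def IsOrderedBlowup {m k : ℕ} (p : Fin m → Fin k) (φ : Equiv.Perm (Fin m)) (t : ℕ)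
    {N : ℕ} (G : SimpleGraph (Fin N)) : Prop :=
  ∃ β : Fin N → Fin m,
    (∀ x : Fin m, {u : Fin N | β u = x}.ncard = t) ∧
    (∀ u v : Fin N, u ≤ v → φ (β u) ≤ φ (β v)) ∧
    (∀ u v : Fin N, G.Adj u v ↔ p (β u) ≠ p (β v))

/-- The complete multipartite graph with part function `p` is a bottlegraph assigned to `H`:
for every interval labeling `φ` there is a `t ≥ 1` such that the ordered blow-up `(B(t), φ)`
has a perfect `H`-tiling. -/
def IsBottlegraph {h m k : ℕ} (H : SimpleGraph (Fin h)) (p : Fin m → Fin k) : Prop :=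
  ∀ φ : Equiv.Perm (Fin m), IsIntervalLabeling p φ →
    ∃ t : ℕ, 0 < t ∧ ∀ (N : ℕ) (G : SimpleGraph (Fin N)),
      IsOrderedBlowup p φ t G → HasPerfectTiling H G

end Bottle

section Tilings

variable {h n : ℕ} {H : SimpleGraph (Fin h)} {G : SimpleGraph (Fin n)}

lemma IsCopySet.hasPerfectTilingOn {S : Finset (Fin n)} (hS : IsCopySet H G S) :
    HasPerfectTilingOn H G S :=
  ⟨{S}, by simpa using hS, by simp, by simp⟩

lemma IsCopySet.card_eq {S : Finset (Fin n)} (hS : IsCopySet H G S) : S.card = h := by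
  obtain ⟨φ, hφ, rfl⟩ := hS
  rw [card_image_of_injective _ hφ.1.injective, card_univ, Fintype.card_fin]

lemma HasPerfectTilingOn.union {S T : Finset (Fin n)} (hS : HasPerfectTilingOn H G S)
    (hT : HasPerfectTilingOn H G T) (hST : Disjoint S T) : HasPerfectTilingOn H G (S ∪ T) := by
  obtain ⟨𝒮, h1, h2, rfl⟩ := hS
  obtain ⟨𝒯, h3, h4, rfl⟩ := hT
  refine ⟨𝒮 ∪ 𝒯, ?_, ?_, union_biUnion⟩
  · intro A hA
    rcases mem_union.1 hA with hA | hA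
    exacts [h1 A hA, h3 A hA]
  · rw [coe_union, Set.pairwiseDisjoint_union]
    refine ⟨h2, h4, fun A hA B hB _ => ?_⟩
    exact hST.mono (subset_biUnion_of_mem id hA) (subset_biUnion_of_mem id hB)

/-- A sequence of blocks, increasing in the vertex order and pairwise completely joined, whose
sizes are those of the classes of an interval colouring of `H`, spans a copy of `H`. -/
lemma isCopySet_biUnion {r : ℕ} {c : Fin h → Fin r} (hc : Monotone c)
    (hcol : ∀ i j, H.Adj i j → c i ≠ c j) {Q : Fin r → Finset (Fin n)}
    (hcard : ∀ k, (Q k).card = (univ.filter fun i => c i = k).card)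
    (hQ : ∀ k l, k < l → ∀ u ∈ Q k, ∀ v ∈ Q l, u < v ∧ G.Adj u v) :
    IsCopySet H G (univ.biUnion Q) := by
  have key : ∀ k, ∃ ψ : Fin h → Fin n, (∀ i j, c i = k → c j = k → i < j → ψ i < ψ j) ∧
      (univ.filter fun i => c i = k).image ψ = Q k := by
    intro k
    set I := univ.filter fun i => c i = k with hI
    have hI' : ∀ i, i ∈ I ↔ c i = k := by simp [hI]
    by_cases hne : (Q k).Nonempty
    · obtain ⟨q, hq⟩ := hne
      let e := I.orderIsoOfFin rfl
      let f := (Q k).orderIsoOfFin (hcard k)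
      refine ⟨fun i => if hi : i ∈ I then (f (e.symm ⟨i, hi⟩) : Fin n) else q, ?_, ?_⟩
      · intro i j hi hj hij
        rw [← hI'] at hi hj
        simp only [hi, hj, dif_pos]
        exact f.strictMono (e.symm.strictMono hij)
      · ext v
        simp only [mem_image]
        constructor
        · rintro ⟨i, hi, rfl⟩
          simp [hi]
        · intro hv
          refine ⟨e (f.symm ⟨v, hv⟩), (e (f.symm ⟨v, hv⟩)).2, ?_⟩
          simp
    · have h0 : Q k = ∅ := not_nonempty_iff_eq_empty.1 hne
      have hI0 : I = ∅ := by
        rw [← card_eq_zero, ← hcard, h0, card_empty]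
      have hno : ∀ i, c i ≠ k := fun i hi => by
        have := (hI' i).2 hi
        simp [hI0] at this
      rcases Nat.eq_zero_or_pos h with rfl | hpos
      · exact ⟨fun i => i.elim0, fun i => i.elim0, by rw [hI0, h0, image_empty]⟩
      · by_cases hn : Nonempty (Fin n)
        · exact ⟨fun _ => hn.some, fun i j hi => (hno i hi).elim, by rw [hI0, h0, image_empty]⟩
        · exfalso
          have hk := hcard (c ⟨0, hpos⟩)
          have : Q (c ⟨0, hpos⟩) = ∅ := by
            rw [← not_nonempty_iff_eq_empty]
            rintro ⟨v, -⟩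
            exact hn ⟨v⟩
          rw [this, card_empty, eq_comm, card_eq_zero] at hk
          have : (⟨0, hpos⟩ : Fin h) ∈ univ.filter fun i => c i = c ⟨0, hpos⟩ := by simp
          simp [hk] at this
  choose ψ hψ hψQ using key
  have hmem : ∀ i, ψ (c i) i ∈ Q (c i) := fun i => by
    rw [← hψQ]
    exact mem_image_of_mem _ (by simp)
  refine ⟨fun i => ψ (c i) i, ⟨?_, ?_⟩, ?_⟩
  · intro i j hij
    rcases (hc hij.le).eq_or_lt with heq | hlt
    · have := hψ (c i) i j rfl heq.symm hij
      simpa only [← heq] using this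
    · exact (hQ _ _ hlt _ (hmem i) _ (hmem j)).1
  · intro i j hij
    rcases (hcol i j hij).lt_or_gt with hlt | hlt
    · exact (hQ _ _ hlt _ (hmem i) _ (hmem j)).2
    · exact (hQ _ _ hlt _ (hmem j) _ (hmem i)).2.symm
  · ext v
    simp only [mem_image, mem_univ, true_and, mem_biUnion]
    constructor
    · rintro ⟨i, rfl⟩
      exact ⟨c i, hmem i⟩
    · rintro ⟨k, hv⟩
      rw [← hψQ, mem_image] at hv
      obtain ⟨i, hi, rfl⟩ := hv
      have hik : c i = k := by simpa using hi
      exact ⟨i, by rw [hik]⟩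

lemma hasIntervalColoring_intervalChi (H : SimpleGraph (Fin h)) :
    HasIntervalColoring H (intervalChi H) :=
  Nat.sInf_mem (s := {k | HasIntervalColoring H k})
    ⟨h, id, monotone_id, fun _ _ hij => hij.ne⟩

lemma intervalChi_le (H : SimpleGraph (Fin h)) : intervalChi H ≤ h :=
  Nat.sInf_le ⟨id, monotone_id, fun _ _ hij => hij.ne⟩

lemma two_le_intervalChi (hH : ∃ a b, H.Adj a b) : 2 ≤ intervalChi H := by
  obtain ⟨a, b, hab⟩ := hH
  obtain ⟨c, -, hc⟩ := hasIntervalColoring_intervalChi H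
  by_contra! hlt
  refine hc a b hab (Fin.ext ?_)
  have := (c a).2
  have := (c b).2
  omega

/-- A colouring with the minimum number of intervals uses every colour. -/
lemma surjective_of_intervalChi {c : Fin h → Fin (intervalChi H)} (hc : Monotone c)
    (hcol : ∀ i j, H.Adj i j → c i ≠ c j) : Function.Surjective c := by
  by_contra hs
  simp only [Function.Surjective, not_forall, not_exists] at hs
  obtain ⟨k, hk⟩ := hs
  have hle : ∀ m, HasIntervalColoring H m → intervalChi H ≤ m := fun m hm => Nat.sInf_le hm
  generalize intervalChi H = r at c k hle
  obtain ⟨m, rfl⟩ : ∃ m, r = m + 1 := ⟨r - 1, by have := k.2; omega⟩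
  choose d hd using fun i => Fin.exists_succAbove_eq (hk i)
  have := hle m ⟨d, fun i j hij => ?_, fun i j hij heq => hcol i j hij ?_⟩
  · omega
  · rw [← (Fin.strictMono_succAbove k).le_iff_le, hd, hd]
    exact hc hij
  · rw [← hd, ← hd, heq]

end Tilings

section Linking

variable {h n : ℕ} {H : SimpleGraph (Fin h)} {G : SimpleGraph (Fin n)}

/-- `u` and `v` can be exchanged in an `H`-tiling with `k` tiles inside `U`: even after deleting
a bounded set `A`, there is `X ⊆ U` of size `k * h - 1` such that both `X ∪ {u}` and `X ∪ {v}`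
have perfect `H`-tilings. -/
def Linked (H : SimpleGraph (Fin h)) (G : SimpleGraph (Fin n)) (U : Finset (Fin n)) (M k : ℕ)
    (u v : Fin n) : Prop :=
  ∀ A : Finset (Fin n), A.card + k * h ≤ M → ∃ X ⊆ U, Disjoint X A ∧ u ∉ X ∧ v ∉ X ∧
    X.card + 1 = k * h ∧ HasPerfectTilingOn H G (insert u X) ∧ HasPerfectTilingOn H G (insert v X)

variable {U : Finset (Fin n)} {M : ℕ}

lemma Linked.symm {k : ℕ} {u v : Fin n} (huv : Linked H G U M k u v) : Linked H G U M k v u := by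
  intro A hA
  obtain ⟨X, h1, h2, h3, h4, h5, h6, h7⟩ := huv A hA
  exact ⟨X, h1, h2, h4, h3, h5, h7, h6⟩

/-- Links compose through any intermediate set which is too large to be deleted. -/
lemma Linked.trans {a b : ℕ} (ha : 1 ≤ a) (hb : 1 ≤ b) (hh : 1 ≤ h) {u v : Fin n}
    {Z : Finset (Fin n)} (hZU : Z ⊆ U) (hZ : M + 2 ≤ Z.card)
    (h1 : ∀ z ∈ Z, Linked H G U M a u z) (h2 : ∀ z ∈ Z, Linked H G U M b z v) :
    Linked H G U M (a + b) u v := by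
  intro A hA
  have hah : 1 ≤ a * h := Nat.mul_pos ha hh
  have hbh : 1 ≤ b * h := Nat.mul_pos hb hh
  rw [add_mul] at hA
  obtain ⟨z, hzZ, hz⟩ : ∃ z ∈ Z, z ∉ insert u (insert v A) := by
    refine exists_mem_notMem_of_card_lt_card (lt_of_lt_of_le ?_ hZ)
    have := card_insert_le u (insert v A)
    have := card_insert_le v A
    omega
  simp only [mem_insert, not_or] at hz
  obtain ⟨hzu, hzv, hzA⟩ := hz
  obtain ⟨X, hXU, hXA, huX, hzX, hXc, hX1, hX2⟩ := h1 z hzZ (insert v A) (by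
    have := card_insert_le v A
    omega)
  obtain ⟨Y, hYU, hYA, hzY, hvY, hYc, hY1, hY2⟩ := h2 z hzZ (insert u (A ∪ X)) (by
    have := card_insert_le u (A ∪ X)
    have := card_union_le A X
    omega)
  rw [disjoint_insert_right] at hXA hYA
  rw [disjoint_union_right] at hYA
  obtain ⟨hvX, hXA⟩ := hXA
  obtain ⟨huY, hYA, hYX⟩ := hYA
  have hzXY : z ∉ X ∪ Y := by simp [hzX, hzY]
  refine ⟨insert z (X ∪ Y), ?_, ?_, ?_, ?_, ?_, ?_, ?_⟩
  · exact insert_subset (hZU hzZ) (union_subset hXU hYU)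
  · simp [disjoint_insert_left, hzA, disjoint_union_left, hXA, hYA]
  · simp [huX, huY, Ne.symm hzu]
  · simp [hvX, hvY, Ne.symm hzv]
  · rw [card_insert_of_notMem hzXY, card_union_of_disjoint hYX.symm, add_mul]
    omega
  · have : insert u (insert z (X ∪ Y)) = insert u X ∪ insert z Y := by
      ext w
      simp only [mem_insert, mem_union]
      tauto
    rw [this]
    refine hX1.union hY1 ?_
    simp [disjoint_insert_left, disjoint_insert_right, huY, hYX.symm, hzX, hzu]
  · have : insert v (insert z (X ∪ Y)) = insert z X ∪ insert v Y := by
      ext w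
      simp only [mem_insert, mem_union]
      tauto
    rw [this]
    refine hX2.union hY2 ?_
    simp [disjoint_insert_left, disjoint_insert_right, hvX, hYX.symm, hzY, Ne.symm hzv]

/-- Two vertices in the same block of an increasing complete multipartite configuration with
`r` parts can be exchanged. -/
lemma linked_of_mem_block {r : ℕ} {c : Fin h → Fin r} (hc : Monotone c)
    (hcol : ∀ i j, H.Adj i j → c i ≠ c j) (hsurj : Function.Surjective c)
    {Q : Fin r → Finset (Fin n)} (hQ : ∀ k l, k < l → ∀ u ∈ Q k, ∀ v ∈ Q l, u < v ∧ G.Adj u v)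
    (hbig : ∀ k, M + 2 ≤ (Q k ∩ U).card) {a : Fin r} {z z' : Fin n} (hz : z ∈ Q a)
    (hz' : z' ∈ Q a) : Linked H G U M 1 z z' := by
  intro A hA
  rw [one_mul] at hA ⊢
  have hex : ∀ k, ∃ R ⊆ (Q k ∩ U) \ insert z (insert z' A),
      R.card = (univ.filter fun i => c i = k).card - if k = a then 1 else 0 := by
    intro k
    apply exists_subset_card_eq
    have h1 := le_card_sdiff (insert z (insert z' A)) (Q k ∩ U)
    have h2 := card_insert_le z (insert z' A)
    have h3 := card_insert_le z' A
    have h4 := hbig k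
    have h5 : (univ.filter fun i => c i = k).card ≤ h := by
      simpa using card_filter_le (univ : Finset (Fin h)) fun i => c i = k
    omega
  choose R hR hRc using hex
  have hRQ : ∀ k, R k ⊆ Q k := fun k v hv => by
    have := hR k hv
    simp only [mem_sdiff, mem_inter] at this
    exact this.1.1
  have hRU : ∀ k, R k ⊆ U := fun k v hv => by
    have := hR k hv
    simp only [mem_sdiff, mem_inter] at this
    exact this.1.2
  have hRA : ∀ k, ∀ v ∈ R k, v ≠ z ∧ v ≠ z' ∧ v ∉ A := fun k v hv => by
    have := hR k hv
    simp only [mem_sdiff, mem_insert, not_or] at this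
    exact this.2
  have hcopy : ∀ w ∈ Q a, (∀ k, w ∉ R k) → IsCopySet H G (insert w (univ.biUnion R)) := by
    intro w hw hwR
    have heq : insert w (univ.biUnion R) =
        univ.biUnion fun k => if k = a then insert w (R k) else R k := by
      ext v
      simp only [mem_insert, mem_biUnion, mem_univ, true_and]
      constructor
      · rintro (rfl | ⟨k, hk⟩)
        · exact ⟨a, by simp⟩
        · refine ⟨k, ?_⟩
          split_ifs
          exacts [mem_insert_of_mem hk, hk]
      · rintro ⟨k, hk⟩
        split_ifs at hk
        · rcases mem_insert.1 hk with hk | hk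
          exacts [Or.inl hk, Or.inr ⟨k, hk⟩]
        · exact Or.inr ⟨k, hk⟩
    rw [heq]
    have hsub : ∀ k, (if k = a then insert w (R k) else R k) ⊆ Q k := by
      intro k
      split_ifs with hk
      · subst hk
        exact insert_subset hw (hRQ k)
      · exact hRQ k
    refine isCopySet_biUnion hc hcol ?_ fun k l hkl u hu v hv =>
      hQ k l hkl u (hsub k hu) v (hsub l hv)
    intro k
    split_ifs with hk
    · rw [card_insert_of_notMem (hwR k), hRc, if_pos hk]
      obtain ⟨i, hi⟩ := hsurj k
      have : 0 < (univ.filter fun i => c i = k).card := card_pos.2 ⟨i, by simp [hi]⟩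
      omega
    · rw [hRc, if_neg hk, Nat.sub_zero]
  have hzR : z ∉ univ.biUnion R := by
    simp only [mem_biUnion, mem_univ, true_and, not_exists]
    exact fun k hk => (hRA k z hk).1 rfl
  have hzR' : z' ∉ univ.biUnion R := by
    simp only [mem_biUnion, mem_univ, true_and, not_exists]
    exact fun k hk => (hRA k z' hk).2.1 rfl
  have hcz := hcopy z hz (by simpa using hzR)
  refine ⟨univ.biUnion R, biUnion_subset.2 fun k _ => hRU k, ?_, hzR, hzR', ?_,
    hcz.hasPerfectTilingOn, (hcopy z' hz' (by simpa using hzR')).hasPerfectTilingOn⟩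
  · rw [disjoint_left]
    simp only [mem_biUnion, mem_univ, true_and]
    rintro v ⟨k, hk⟩
    exact (hRA k v hk).2.2
  · rw [← card_insert_of_notMem hzR, hcz.card_eq]

/-- Two vertices in the same or in consecutive blocks of an increasing complete
`(r + 1)`-partite configuration can be exchanged. -/
lemma linked_of_predAbove {r : ℕ} {c : Fin h → Fin r} (hc : Monotone c)
    (hcol : ∀ i j, H.Adj i j → c i ≠ c j) (hsurj : Function.Surjective c)
    {P : Fin (r + 1) → Finset (Fin n)}
    (hP : ∀ k l, k < l → ∀ u ∈ P k, ∀ v ∈ P l, u < v ∧ G.Adj u v) {a : Fin r}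
    (hbig : ∀ k, ∃ j, a.predAbove j = k ∧ M + 2 ≤ (P j ∩ U).card) {i j : Fin (r + 1)}
    (hi : a.predAbove i = a) (hj : a.predAbove j = a) {z z' : Fin n} (hz : z ∈ P i)
    (hz' : z' ∈ P j) : Linked H G U M 1 z z' := by
  refine linked_of_mem_block (Q := fun k => (univ.filter fun j => a.predAbove j = k).biUnion P)
    (a := a) hc hcol hsurj ?_ ?_ ?_ ?_
  · intro k l hkl u hu v hv
    simp only [mem_biUnion, mem_filter, mem_univ, true_and] at hu hv
    obtain ⟨p, rfl, hu⟩ := hu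
    obtain ⟨q, rfl, hv⟩ := hv
    refine hP p q ?_ u hu v hv
    by_contra! hqp
    exact absurd (Fin.predAbove_right_monotone a hqp) (not_le.2 hkl)
  · intro k
    obtain ⟨p, hp, hpc⟩ := hbig k
    refine hpc.trans (card_le_card (inter_subset_inter_right ?_))
    exact subset_biUnion_of_mem P (by simpa using hp)
  · exact mem_biUnion.2 ⟨i, by simpa using hi, hz⟩
  · exact mem_biUnion.2 ⟨j, by simpa using hj, hz'⟩

lemma exists_predAbove_eq_of_ne {r : ℕ} {a : Fin r} {b : Fin (r + 1)}
    (hb : b = a.castSucc ∨ b = a.succ) (k : Fin r) : ∃ j, j ≠ b ∧ a.predAbove j = k := by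
  rcases hb with rfl | rfl
  · rcases lt_or_ge k a with hk | hk
    · exact ⟨k.castSucc, by simpa using hk.ne, Fin.predAbove_castSucc_of_le _ _ hk.le⟩
    · refine ⟨k.succ, ?_, Fin.predAbove_succ_of_le _ _ hk⟩
      simp only [ne_eq, Fin.ext_iff, Fin.val_succ, Fin.val_castSucc]
      have : (a : ℕ) ≤ k := hk
      omega
  · rcases le_or_gt k a with hk | hk
    · refine ⟨k.castSucc, ?_, Fin.predAbove_castSucc_of_le _ _ hk⟩
      simp only [ne_eq, Fin.ext_iff, Fin.val_succ, Fin.val_castSucc]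
      have : (k : ℕ) ≤ a := hk
      omega
    · exact ⟨k.succ, by simpa using hk.ne', Fin.predAbove_succ_of_le _ _ hk.le⟩

/-- Any two vertices of an increasing complete `(r + 1)`-partite configuration are linked, the
number of steps being at least the distance of their blocks. -/
lemma linked_of_dist_le {r : ℕ} (hr : 1 ≤ r) (hh : 1 ≤ h) {c : Fin h → Fin r} (hc : Monotone c)
    (hcol : ∀ i j, H.Adj i j → c i ≠ c j) (hsurj : Function.Surjective c)
    {P : Fin (r + 1) → Finset (Fin n)}
    (hP : ∀ k l, k < l → ∀ u ∈ P k, ∀ v ∈ P l, u < v ∧ G.Adj u v)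
    (hPU : ∀ k, P k ⊆ U) (hbig : ∀ k, M + 2 ≤ (P k).card) (k : ℕ) :
    ∀ i j : Fin (r + 1), (i : ℕ) ≤ j + (k + 1) → (j : ℕ) ≤ i + (k + 1) →
      ∀ z ∈ P i, ∀ z' ∈ P j, Linked H G U M (k + 1) z z' := by
  have hstep : ∀ i j : Fin (r + 1), (i : ℕ) ≤ j + 1 → (j : ℕ) ≤ i + 1 →
      ∀ z ∈ P i, ∀ z' ∈ P j, Linked H G U M 1 z z' := by
    intro i j hij hji z hz z' hz'
    obtain ⟨a, hai, haj⟩ : ∃ a : Fin r, (i = a.castSucc ∨ i = a.succ) ∧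
        (j = a.castSucc ∨ j = a.succ) := by
      simp only [Fin.ext_iff, Fin.val_succ, Fin.val_castSucc]
      have hi := i.2
      have hj := j.2
      by_cases hm : min (i : ℕ) j < r
      · refine ⟨⟨min (i : ℕ) j, hm⟩, ?_, ?_⟩ <;> simp only <;> omega
      · refine ⟨⟨r - 1, by omega⟩, ?_, ?_⟩ <;> simp only <;> omega
    have hpa : ∀ l : Fin (r + 1), l = a.castSucc ∨ l = a.succ → a.predAbove l = a := by
      rintro l (rfl | rfl) <;> simp
    refine linked_of_predAbove hc hcol hsurj hP (fun l => ?_) (hpa i hai) (hpa j haj) hz hz'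
    obtain ⟨m, -, hm⟩ := exists_predAbove_eq_of_ne hai l
    exact ⟨m, hm, by rw [inter_eq_left.2 (hPU m)]; exact hbig m⟩
  induction k with
  | zero => simpa using hstep
  | succ k ih =>
    intro i j hij hji z hz z' hz'
    obtain ⟨m, h1, h2, h3, h4⟩ : ∃ m : Fin (r + 1), (i : ℕ) ≤ m + 1 ∧ (m : ℕ) ≤ i + 1 ∧
        (m : ℕ) ≤ j + (k + 1) ∧ (j : ℕ) ≤ m + (k + 1) := by
      have hi := i.2
      have hj := j.2
      rcases lt_trichotomy (i : ℕ) j with hlt | heq | hgt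
      · exact ⟨⟨i + 1, by omega⟩, by simp only; omega⟩
      · exact ⟨i, by omega⟩
      · exact ⟨⟨i - 1, by omega⟩, by simp only; omega⟩
    rw [add_comm (k + 1) 1]
    exact Linked.trans le_rfl (by omega) hh (hPU m) (hbig m)
      (fun w hw => hstep i m h1 h2 z hz w hw) fun w hw => ih m j h3 h4 w hw z' hz'

/-- The blocks are pairwise separated in the vertex order and completely joined. -/
def Separated {ι : Type*} (G : SimpleGraph (Fin n)) (P : ι → Finset (Fin n)) : Prop :=
  ∀ i j, i ≠ j → (∀ u ∈ P i, ∀ v ∈ P j, u < v ∧ G.Adj u v) ∨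
    ∀ u ∈ P i, ∀ v ∈ P j, v < u ∧ G.Adj u v

lemma Separated.exists_perm {m : ℕ} {P : Fin m → Finset (Fin n)} (hP : Separated G P)
    (hne : ∀ i, (P i).Nonempty) :
    ∃ σ : Equiv.Perm (Fin m), ∀ k l, k < l → ∀ u ∈ P (σ k), ∀ v ∈ P (σ l), u < v ∧ G.Adj u v := by
  choose p hp using hne
  refine ⟨Tuple.sort p, fun k l hkl => ?_⟩
  rcases hP _ _ ((Tuple.sort p).injective.ne hkl.ne) with hlt | hgt
  · exact hlt
  · exact absurd (Tuple.monotone_sort p hkl.le) (not_le.2 (hgt _ (hp _) _ (hp _)).1)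

/-- If the blocks `P 0, …, P r` are separated and remain so when the last one is replaced with
`{x}`, then `x` is linked to all vertices of these blocks. -/
lemma linked_of_separated {r : ℕ} (hr : 1 ≤ r) (hh : 1 ≤ h) {c : Fin h → Fin r} (hc : Monotone c)
    (hcol : ∀ i j, H.Adj i j → c i ≠ c j) (hsurj : Function.Surjective c)
    {P : Fin (r + 1) → Finset (Fin n)} {x : Fin n} (hP : Separated G P)
    (hPx : Separated G (Function.update P (Fin.last r) {x}))
    (hPU : ∀ k, P k ⊆ U) (hbig : ∀ k, M + 2 ≤ (P k).card) {k : ℕ} (hk : r ≤ k)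
    {i : Fin (r + 1)} {z : Fin n} (hz : z ∈ P i) : Linked H G U M (k + 1) x z := by
  have hne : ∀ j, (P j).Nonempty := fun j => card_pos.1 (by have := hbig j; omega)
  obtain ⟨σ, hσ⟩ := hP.exists_perm hne
  have hall : ∀ j, ∀ w ∈ P j, Linked H G U M k w z := by
    intro j w hw
    obtain ⟨k, rfl⟩ : ∃ k', k = k' + 1 := ⟨k - 1, by omega⟩
    refine linked_of_dist_le (P := P ∘ σ) hr hh hc hcol hsurj hσ (fun _ => hPU _) (fun _ => hbig _)
      k (σ.symm j) (σ.symm i) ?_ ?_ w (by simpa using hw) z (by simpa using hz)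
    · have := (σ.symm j).2
      omega
    · have := (σ.symm i).2
      omega
  obtain ⟨j, hj⟩ : ∃ j, ∀ w ∈ P j, Linked H G U M 1 x w := by
    set P' := Function.update P (Fin.last r) {x} with hP'
    obtain ⟨τ, hτ⟩ := hPx.exists_perm fun j => by
      rcases eq_or_ne j (Fin.last r) with rfl | hj
      · rw [hP', Function.update_self]
        exact singleton_nonempty x
      · rw [hP', Function.update_of_ne hj]
        exact hne j
    set b := τ.symm (Fin.last r) with hb
    have hτne : ∀ l, l ≠ b → P' (τ l) = P (τ l) := fun l hl => by
      rw [hP', Function.update_of_ne]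
      rintro heq
      exact hl (by rw [hb, ← heq, Equiv.symm_apply_apply])
    obtain ⟨a, ha⟩ : ∃ a : Fin r, b = a.castSucc ∨ b = a.succ := by
      simp only [Fin.ext_iff, Fin.val_succ, Fin.val_castSucc]
      by_cases hbr : (b : ℕ) < r
      · exact ⟨⟨b, hbr⟩, Or.inl rfl⟩
      · exact ⟨⟨r - 1, by omega⟩, Or.inr (by have := b.2; simp; omega)⟩
    have hba : a.predAbove b = a := by rcases ha with ha | ha <;> rw [ha] <;> simp
    obtain ⟨l, hlb, hl⟩ := exists_predAbove_eq_of_ne ha a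
    refine ⟨τ l, fun w hw => ?_⟩
    refine linked_of_predAbove (P := P' ∘ τ) hc hcol hsurj hτ (fun m => ?_) hba hl ?_ ?_
    · obtain ⟨m', hm'b, hm'⟩ := exists_predAbove_eq_of_ne ha m
      refine ⟨m', hm', ?_⟩
      rw [Function.comp_apply, hτne _ hm'b, inter_eq_left.2 (hPU _)]
      exact hbig _
    · simp [hP', hb]
    · rw [Function.comp_apply, hτne _ hlb]
      exact hw
  rw [add_comm]
  exact Linked.trans le_rfl (hr.trans hk) hh (hPU j) (hbig j) hj (hall j)

end Linking

section Counting

open Classical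

lemma pow_mul_card_le_sum_pow {α : Type*} (s : Finset α) {f : α → ℝ} (hf : ∀ a ∈ s, 0 ≤ f a)
    {c : ℝ} (hc : 0 ≤ c) (hcf : c * s.card ≤ ∑ a ∈ s, f a) (m : ℕ) :
    c ^ m * s.card ≤ ∑ a ∈ s, f a ^ m := by
  rcases m with _ | m
  · simp
  rcases s.eq_empty_or_nonempty with rfl | hs
  · simp
  have hpos : (0 : ℝ) < s.card := by exact_mod_cast hs.card_pos
  refine le_trans ?_ (pow_sum_div_card_le_sum_pow (n := m) hf)
  rw [le_div_iff₀ (by positivity)]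
  calc c ^ (m + 1) * s.card * (s.card : ℝ) ^ m = (c * s.card) ^ (m + 1) := by ring
    _ ≤ _ := by gcongr

/-- Double counting the extensions of tuples to members of a family of longer tuples. -/
lemma pow_mul_card_le_sum_card_extend {V : Type*} [Fintype V] [Nonempty V] {t k : ℕ}
    (S : Finset (Fin (k + 1) → V)) {c : ℝ} (hc : 0 ≤ c)
    (hcS : c * (Fintype.card V : ℝ) ^ (k + 1) ≤ S.card) :
    c ^ t * (Fintype.card V : ℝ) ^ t * (Fintype.card V : ℝ) ^ k ≤
      ∑ a : Fin t → V, ((univ.filter fun f : Fin k → V =>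
        ∀ i, (Fin.cons (a i) f : Fin (k + 1) → V) ∈ S).card : ℝ) := by
  let D : (Fin k → V) → Finset V := fun f =>
    univ.filter fun v => (Fin.cons v f : Fin (k + 1) → V) ∈ S
  have hD : ∑ f, ((D f).card : ℝ) = S.card := by
    norm_cast
    rw [← card_sigma]
    refine card_bij' (fun p _ => Fin.cons p.2 p.1) (fun f _ => ⟨Fin.tail f, f 0⟩) ?_ ?_ ?_ ?_
    · rintro ⟨f, v⟩ h
      simpa [D] using h
    · intro f hf
      simpa [D, Fin.cons_self_tail] using hf
    · rintro ⟨f, v⟩ _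
      simp
    · intro f _
      simp [Fin.cons_self_tail]
  have hDpow : ∀ f, ((D f).card : ℝ) ^ t = ((univ.filter fun a : Fin t → V =>
      ∀ i, (Fin.cons (a i) f : Fin (k + 1) → V) ∈ S).card : ℝ) := by
    intro f
    have : (univ.filter fun a : Fin t → V => ∀ i, (Fin.cons (a i) f : Fin (k + 1) → V) ∈ S) =
        Fintype.piFinset fun _ : Fin t => D f := by
      ext a
      simp [D, Fintype.mem_piFinset]
    rw [this, Fintype.card_piFinset]
    simp
  have hDS : ∑ a : Fin t → V, ((univ.filter fun f : Fin k → V =>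
        ∀ i, (Fin.cons (a i) f : Fin (k + 1) → V) ∈ S).card : ℝ) = ∑ f, ((D f).card : ℝ) ^ t := by
    simp_rw [hDpow]
    norm_cast
    exact sum_card_bipartiteAbove_eq_sum_card_bipartiteBelow
      (s := univ) (t := univ) fun (a : Fin t → V) (f : Fin k → V) =>
        ∀ i, (Fin.cons (a i) f : Fin (k + 1) → V) ∈ S
  have hcard : ((univ : Finset (Fin k → V)).card : ℝ) = (Fintype.card V : ℝ) ^ k := by simp
  rw [hDS, ← mul_pow, ← hcard]
  refine pow_mul_card_le_sum_pow _ (fun _ _ => by positivity) (by positivity) ?_ t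
  rw [hD, hcard, mul_assoc, ← pow_succ']
  exact hcS

/-- Supersaturation for blow-ups of a dense family of functions `Fin k → V`. -/
lemma le_card_blowup_fin {V : Type*} [Fintype V] [Nonempty V] (t k : ℕ) :
    ∀ (S : Finset (Fin k → V)) (c : ℝ), 0 ≤ c → c * (Fintype.card V : ℝ) ^ k ≤ S.card →
      c ^ t ^ k * (Fintype.card V : ℝ) ^ (t * k) ≤
        (univ.filter fun F : Fin k → Fin t → V => ∀ g : Fin k → Fin t,
          (fun i => F i (g i)) ∈ S).card := by
  have hn : (0 : ℝ) < Fintype.card V := by exact_mod_cast Fintype.card_pos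
  induction k with
  | zero =>
    intro S c _ hcS
    simp only [pow_zero, mul_one, mul_zero, pow_one] at hcS ⊢
    refine hcS.trans ?_
    norm_cast
    refine card_le_card_of_injOn (fun _ i => i.elim0) (fun f hf => ?_) fun f _ g _ _ =>
      Subsingleton.elim _ _
    simp only [coe_filter, mem_univ, true_and, Set.mem_ofPred_eq]
    intro g
    rwa [Subsingleton.elim (fun i : Fin 0 => (i.elim0 : Fin t → V) (g i)) f]
  | succ k ih =>
    intro S c hc hcS
    let S' : (Fin t → V) → Finset (Fin k → V) := fun a =>
      univ.filter fun f => ∀ i, (Fin.cons (a i) f : Fin (k + 1) → V) ∈ S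
    let 𝓕 : (Fin t → V) → Finset (Fin k → Fin t → V) := fun a =>
      univ.filter fun F => ∀ g : Fin k → Fin t, (fun i => F i (g i)) ∈ S' a
    have hcard : ((univ : Finset (Fin t → V)).card : ℝ) = (Fintype.card V : ℝ) ^ t := by simp
    have hS' : c ^ t * (univ : Finset (Fin t → V)).card ≤
        ∑ a, ((S' a).card : ℝ) / (Fintype.card V : ℝ) ^ k := by
      rw [← sum_div, le_div_iff₀ (by positivity), hcard]
      exact pow_mul_card_le_sum_card_extend S hc hcS
    have hih : ∀ a, (((S' a).card : ℝ) / (Fintype.card V : ℝ) ^ k) ^ t ^ k *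
        (Fintype.card V : ℝ) ^ (t * k) ≤ (𝓕 a).card := by
      intro a
      have hd : (0 : ℝ) ≤ ((S' a).card : ℝ) / (Fintype.card V : ℝ) ^ k := by positivity
      have hc : ((S' a).card : ℝ) / (Fintype.card V : ℝ) ^ k * (Fintype.card V : ℝ) ^ k ≤
          (S' a).card := by rw [div_mul_cancel₀ _ (by positivity)]
      exact ih (S' a) _ hd hc
    have hsum := pow_mul_card_le_sum_pow (univ : Finset (Fin t → V))
      (f := fun a => ((S' a).card : ℝ) / (Fintype.card V : ℝ) ^ k)
      (fun _ _ => by positivity) (c := c ^ t) (by positivity) hS' (t ^ k)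
    calc c ^ t ^ (k + 1) * (Fintype.card V : ℝ) ^ (t * (k + 1))
        = (c ^ t) ^ t ^ k * (univ : Finset (Fin t → V)).card *
            (Fintype.card V : ℝ) ^ (t * k) := by
          rw [hcard, ← pow_mul, pow_succ' t k]
          ring
      _ ≤ (∑ a, (((S' a).card : ℝ) / (Fintype.card V : ℝ) ^ k) ^ t ^ k) *
            (Fintype.card V : ℝ) ^ (t * k) := by gcongr
      _ ≤ ∑ a, ((𝓕 a).card : ℝ) := by
          rw [sum_mul]
          exact sum_le_sum fun a _ => hih a
      _ ≤ _ := by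
          norm_cast
          rw [← card_sigma]
          refine card_le_card_of_injOn (fun p => Fin.cons p.1 p.2) ?_ ?_
          · rintro ⟨a, F⟩ h
            simp only [coe_sigma, Set.mem_sigma_iff, coe_univ, Set.mem_univ, true_and, coe_filter,
              mem_univ, Set.mem_ofPred_eq, S', 𝓕, mem_filter] at h ⊢
            intro g
            convert h (fun i => g i.succ) (g 0) using 1
            funext i
            refine Fin.cases ?_ (fun j => ?_) i <;> simp
          · rintro ⟨a, F⟩ _ ⟨b, F'⟩ _ heq
            obtain ⟨rfl, rfl⟩ := Fin.cons_injective2 heq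
            rfl

/-- Supersaturation for blow-ups of a dense family of functions `ι → V`. -/
lemma exists_blowup_family {ι V : Type*} [Fintype ι] [Fintype V] [Nonempty V] (t : ℕ)
    (S : Finset (ι → V)) {c : ℝ} (hc : 0 ≤ c)
    (hcS : c * (Fintype.card V : ℝ) ^ Fintype.card ι ≤ S.card) :
    ∃ T : Finset (ι × Fin t → V),
      c ^ t ^ Fintype.card ι * (Fintype.card V : ℝ) ^ (t * Fintype.card ι) ≤ T.card ∧
        ∀ F ∈ T, ∀ g : ι → Fin t, (fun i => F (i, g i)) ∈ S := by
  refine ⟨univ.filter fun F => ∀ g : ι → Fin t, (fun i => F (i, g i)) ∈ S, ?_,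
    fun F hF => (mem_filter.1 hF).2⟩
  let e := Fintype.equivFin ι
  have := le_card_blowup_fin t (Fintype.card ι)
    (S.map (e.arrowCongr (Equiv.refl V)).toEmbedding) c hc (by rwa [card_map])
  refine this.trans ?_
  norm_cast
  refine card_le_card_of_injOn (fun F p => F (e p.1) p.2) ?_ ?_
  · intro F hF
    simp only [coe_filter, mem_univ, true_and, Set.mem_ofPred_eq] at hF ⊢
    intro g
    obtain ⟨f, hf, hfF⟩ := mem_map.1 (hF fun j => g (e.symm j))
    convert hf using 1
    funext i
    have := congrFun hfF (e i)
    simpa [Equiv.arrowCongr] using this.symm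
  · intro F _ F' _ heq
    funext j a
    simpa using congrFun heq (e.symm j, a)

/-- Almost all functions are injective. -/
lemma card_mul_le_of_not_injective {α V : Type*} [Fintype α] [Fintype V] {𝓕 : Finset (α → V)}
    (h𝓕 : ∀ F ∈ 𝓕, ¬ Function.Injective F) :
    (𝓕.card : ℝ) * Fintype.card V ≤
      (Fintype.card α : ℝ) ^ 2 * (Fintype.card V : ℝ) ^ Fintype.card α := by
  have hsub : 𝓕 ⊆
      (univ : Finset α).offDiag.biUnion fun p => univ.filter fun F => F p.1 = F p.2 := by
    intro F hF
    have := h𝓕 F hF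
    simp only [Function.Injective, not_forall] at this
    obtain ⟨a, b, hab, hne⟩ := this
    simp only [mem_biUnion, mem_offDiag, mem_univ, true_and, mem_filter]
    exact ⟨(a, b), hne, hab⟩
  have hpair : ∀ p ∈ (univ : Finset α).offDiag,
      (univ.filter fun F : α → V => F p.1 = F p.2).card * Fintype.card V ≤
        Fintype.card V ^ Fintype.card α := by
    rintro ⟨a, b⟩ hp
    have hab : a ≠ b := by simpa using hp
    rw [← card_univ (α := V), ← card_product]
    have : Fintype.card V ^ Fintype.card α = (univ : Finset (α → V)).card := by simp
    rw [card_univ, this]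
    refine card_le_card_of_injOn (fun q => Function.update q.1 a q.2) (by simp) ?_
    rintro ⟨F, v⟩ hF ⟨F', v'⟩ hF' heq
    simp only [coe_product, coe_filter, mem_univ, true_and, Set.mem_prod,
      Set.mem_ofPred_eq] at hF hF'
    have hv : v = v' := by simpa using congrFun heq a
    have hF2 : ∀ i, i ≠ a → F i = F' i := fun i hi => by simpa [hi] using congrFun heq i
    have : F = F' := by
      funext i
      by_cases hi : i = a
      · rw [hi, hF.1, hF'.1]
        exact hF2 b hab.symm
      · exact hF2 i hi
    rw [hv, this]
  have : 𝓕.card * Fintype.card V ≤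
      Fintype.card α ^ 2 * Fintype.card V ^ Fintype.card α := by
    calc _ ≤ (∑ p ∈ (univ : Finset α).offDiag,
          (univ.filter fun F : α → V => F p.1 = F p.2).card) * Fintype.card V := by
          gcongr
          exact (card_le_card hsub).trans card_biUnion_le
      _ ≤ ∑ p ∈ (univ : Finset α).offDiag, Fintype.card V ^ Fintype.card α := by
          rw [sum_mul]
          exact sum_le_sum hpair
      _ ≤ _ := by
          rw [sum_const, smul_eq_mul, offDiag_card, card_univ, pow_two (Fintype.card α)]
          gcongr
          exact Nat.sub_le _ _
  exact_mod_cast this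

/-- If the range of every function in `𝓕` contains a member of `𝒳`, a family of `q`-sets, then
`𝒳` has positive density whenever `𝓕` does. -/
lemma card_le_of_forall_exists_subset_range {α V : Type*} [Fintype α] [Fintype V] [LinearOrder V]
    (𝓕 : Finset (α → V)) (𝒳 : Finset (Finset V)) {q : ℕ} (hq : ∀ X ∈ 𝒳, X.card = q)
    (h𝓕 : ∀ F ∈ 𝓕, ∃ X ∈ 𝒳, X ⊆ univ.image F) :
    𝓕.card ≤ Fintype.card α ^ q * (𝒳.card * Fintype.card V ^ (Fintype.card α - q)) := by
  have h1 : ∀ F : 𝓕, ∃ X : 𝒳, ∃ τ : Fin q → α, ∀ k,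
      F.1 (τ k) = (X : Finset V).orderEmbOfFin (hq X X.2) k := by
    rintro ⟨F, hF⟩
    obtain ⟨X, hX, hXF⟩ := h𝓕 F hF
    have : ∀ k, ∃ a, F a = X.orderEmbOfFin (hq X hX) k := fun k => by
      simpa using hXF (X.orderEmbOfFin_mem (hq X hX) k)
    choose τ hτ using this
    exact ⟨⟨X, hX⟩, τ, hτ⟩
  choose X τ hτ using h1
  have hinj : ∀ F, Function.Injective (τ F) := fun F k l hkl => by
    have := hτ F k
    rw [hkl, hτ F l] at this
    exact (RelEmbedding.injective _ this).symm
  have h2 : ∀ σ : Fin q → α, (univ.filter fun F => τ F = σ).card ≤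
      𝒳.card * Fintype.card V ^ (Fintype.card α - q) := by
    intro σ
    by_cases hσ : ∃ F, τ F = σ
    · have hσi : Function.Injective σ := by
        obtain ⟨F, rfl⟩ := hσ
        exact hinj F
      have hcard : Fintype.card {a // a ∉ univ.image σ} = Fintype.card α - q := by
        rw [Fintype.card_subtype_compl, Fintype.card_coe, card_image_of_injective _ hσi]
        simp
      have : 𝒳.card * Fintype.card V ^ (Fintype.card α - q) =
          (univ : Finset (𝒳 × ({a // a ∉ univ.image σ} → V))).card := by
        rw [card_univ, Fintype.card_prod, Fintype.card_coe, Fintype.card_fun, hcard]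
      rw [this]
      refine card_le_card_of_injOn (fun F => (X F, fun a => F.1 a)) (by simp) ?_
      intro F hF F' hF' heq
      simp only [coe_filter, mem_univ, true_and, Set.mem_ofPred_eq] at hF hF'
      simp only [Prod.mk.injEq] at heq
      obtain ⟨hX, hrest⟩ := heq
      refine Subtype.ext (funext fun a => ?_)
      by_cases ha : a ∈ univ.image σ
      · obtain ⟨k, -, rfl⟩ := mem_image.1 ha
        have e1 := hτ F k
        have e2 := hτ F' k
        rw [hF] at e1
        rw [hF'] at e2
        rw [e1, e2]
        simp only [hX]
      · exact congrFun hrest ⟨a, ha⟩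
    · push Not at hσ
      simp [hσ]
  calc 𝓕.card = (univ : Finset 𝓕).card := by simp
    _ = ∑ σ : Fin q → α, (univ.filter fun F => τ F = σ).card :=
        card_eq_sum_card_fiberwise fun _ _ => mem_coe.2 (mem_univ _)
    _ ≤ ∑ σ : Fin q → α, 𝒳.card * Fintype.card V ^ (Fintype.card α - q) :=
        sum_le_sum fun σ _ => h2 σ
    _ = _ := by simp

/-- Choosing the entries of a tuple one after the other, with at least `m` choices each time. -/
lemma pow_le_card_sequences {V : Type*} [Fintype V] {m : ℝ} (hm : 0 ≤ m)
    (R : ∀ k, (Fin k → V) → V → Prop) (N : ℕ)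
    (hR : ∀ k < N, ∀ f, m ≤ (univ.filter fun v => R k f v).card) :
    ∃ T : Finset (Fin N → V), m ^ N ≤ T.card ∧
      ∀ f ∈ T, ∀ k : Fin N, R k (fun j => f (Fin.castLE k.2.le j)) (f k) := by
  refine ⟨univ.filter fun f : Fin N → V =>
    ∀ k : Fin N, R k (fun j => f (Fin.castLE k.2.le j)) (f k), ?_, fun f hf =>
      (mem_filter.1 hf).2⟩
  induction N with
  | zero => simp
  | succ N ih =>
    set T := univ.filter fun f : Fin N → V =>
      ∀ k : Fin N, R k (fun j => f (Fin.castLE k.2.le j)) (f k) with hT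
    calc m ^ (N + 1) ≤ T.card * m := by
          rw [pow_succ]
          gcongr
          exact ih fun k hk => hR k (by omega)
      _ ≤ ∑ f ∈ T, ((univ.filter fun v => R N f v).card : ℝ) := by
          rw [← nsmul_eq_mul]
          exact card_nsmul_le_sum _ _ _ fun f _ => hR N (by omega) f
      _ ≤ _ := by
          norm_cast
          rw [← card_sigma]
          refine card_le_card_of_injOn (fun p => Fin.snoc (α := fun _ => V) p.1 p.2) ?_ ?_
          · rintro ⟨f, v⟩ hp
            simp only [coe_sigma, Set.mem_sigma_iff, mem_coe, hT, mem_filter, mem_univ,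
              true_and] at hp ⊢
            intro k
            refine Fin.lastCases ?_ (fun k => ?_) k
            · have h1 : (fun j : Fin N => Fin.snoc (α := fun _ => V) f v j.castSucc) = f := by
                funext j
                exact Fin.snoc_castSucc (α := fun _ => V) v f j
              change R N (fun j : Fin N => Fin.snoc (α := fun _ => V) f v j.castSucc)
                (Fin.snoc (α := fun _ => V) f v (Fin.last N))
              rw [h1, Fin.snoc_last]
              exact hp.2
            · have h1 : (fun j : Fin k => Fin.snoc (α := fun _ => V) f v
                  (Fin.castLE k.2.le j).castSucc) = fun j => f (Fin.castLE k.2.le j) := by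
                funext j
                exact Fin.snoc_castSucc (α := fun _ => V) v f _
              change R k (fun j : Fin k => Fin.snoc (α := fun _ => V) f v
                (Fin.castLE k.2.le j).castSucc) (Fin.snoc (α := fun _ => V) f v k.castSucc)
              rw [h1, Fin.snoc_castSucc]
              exact hp.1 k
          · rintro ⟨f, v⟩ _ ⟨g, w⟩ _ heq
            obtain ⟨rfl, rfl⟩ := Fin.snoc_injective2 heq
            rfl

end Counting

section Connectors

open Classical

variable {h n r : ℕ} {H : SimpleGraph (Fin h)} {G : SimpleGraph (Fin n)}

/-- Large minimum degree forces many common neighbours of at most `r` vertices. -/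
lemma le_card_common_neighbors {η : ℝ} (hη : η ≤ 1) (hr : 1 ≤ r)
    (hδ : ∀ v, (1 - 1 / (r : ℝ) + η) * n ≤ odeg G v) (hη0 : 0 ≤ η) {D : Finset (Fin n)}
    (hD : D.card ≤ r) :
    η * n ≤ (univ.filter fun u => ∀ d ∈ D, G.Adj d u).card := by
  have hr0 : (0 : ℝ) < r := by exact_mod_cast hr
  have hn0 : (0 : ℝ) ≤ n := Nat.cast_nonneg n
  have hnon : ∀ d, ((univ.filter fun u => ¬ G.Adj d u).card : ℝ) ≤ (1 / r - η) * n := by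
    intro d
    have h1 : (univ.filter fun u => G.Adj d u).card = odeg G d := by
      rw [odeg, Set.ncard_eq_toFinset_card']
      congr 1
      ext u
      simp
    have h2 : ((univ.filter fun u => G.Adj d u).card : ℝ) +
        (univ.filter fun u => ¬ G.Adj d u).card = n := by
      exact_mod_cast (card_filter_add_card_filter_not (s := univ) fun u => G.Adj d u).trans
        (by simp)
    rw [h1] at h2
    linarith [hδ d]
  rcases D.eq_empty_or_nonempty with rfl | ⟨d₀, -⟩
  · simpa using mul_le_of_le_one_left hn0 hη
  have hpos : 0 ≤ (1 / (r : ℝ) - η) * n := le_trans (Nat.cast_nonneg _) (hnon d₀)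
  have hcover : (univ : Finset (Fin n)) ⊆ (univ.filter fun u => ∀ d ∈ D, G.Adj d u) ∪
      D.biUnion fun d => univ.filter fun u => ¬ G.Adj d u := by
    intro u _
    by_cases hu : ∀ d ∈ D, G.Adj d u
    · exact mem_union_left _ (by simpa using hu)
    · push Not at hu
      refine mem_union_right _ ?_
      simpa using hu
  have h3 : (n : ℝ) ≤ (univ.filter fun u => ∀ d ∈ D, G.Adj d u).card +
      ∑ d ∈ D, ((univ.filter fun u => ¬ G.Adj d u).card : ℝ) := by
    have := (card_le_card hcover).trans ((card_union_le _ _).trans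
      (Nat.add_le_add_left card_biUnion_le _))
    rw [card_univ, Fintype.card_fin] at this
    exact_mod_cast this
  have h4 : ∑ d ∈ D, ((univ.filter fun u => ¬ G.Adj d u).card : ℝ) ≤ r * ((1 / r - η) * n) :=
    calc _ ≤ D.card • ((1 / (r : ℝ) - η) * n) := sum_le_card_nsmul _ _ _ fun d _ => hnon d
      _ ≤ _ := by
        rw [nsmul_eq_mul]
        gcongr
  have h5 : (r : ℝ) * ((1 / r - η) * n) = n - r * (η * n) := by
    field_simp
  have h6 : η * n ≤ r * (η * n) :=
    le_mul_of_one_le_left (by positivity) (by exact_mod_cast hr)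
  linarith

/-- The positions of the two cliques sharing the vertex in position `none`. -/
def cliqueIndex (b : Bool) : Fin (r + 1) → Option (Bool × Fin r) :=
  Fin.cons none fun j => some (b, j)

/-- `f` describes two `(r + 1)`-cliques sharing a vertex such that replacing the last vertex of
the clique labelled `b` by `e b` yields again a clique. -/
def IsConnector (G : SimpleGraph (Fin n)) (e : Bool → Fin n)
    (f : Option (Bool × Fin r) → Fin n) : Prop :=
  ∀ b, (∀ i j, i ≠ j → G.Adj (f (cliqueIndex b i)) (f (cliqueIndex b j))) ∧
    ∀ i, i ≠ Fin.last r → G.Adj (f (cliqueIndex b i)) (e b)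

/-- There are many cliques `p` of order `r` in the neighbourhood of `v` such that `w` is adjacent
to all vertices of `p` but possibly the last one. -/
lemma exists_family_cliques {η : ℝ} (hη0 : 0 ≤ η) (hη : η ≤ 1) (hr : 1 ≤ r)
    (hδ : ∀ v, (1 - 1 / (r : ℝ) + η) * n ≤ odeg G v) (v w : Fin n) :
    ∃ T : Finset (Fin r → Fin n), (η * n) ^ r ≤ T.card ∧ ∀ p ∈ T, (∀ j, G.Adj v (p j)) ∧
      (∀ i j, i < j → G.Adj (p i) (p j)) ∧ ∀ j : Fin r, (j : ℕ) + 1 < r → G.Adj w (p j) := by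
  let D : ∀ k, (Fin k → Fin n) → Finset (Fin n) := fun k f =>
    insert v (univ.image f) ∪ (if k + 1 < r then {w} else ∅)
  have hD : ∀ k < r, ∀ f, (D k f).card ≤ r := by
    intro k hk f
    have h1 : (insert v (univ.image f)).card ≤ k + 1 :=
      (card_insert_le _ _).trans (Nat.succ_le_succ (card_image_le.trans (by simp)))
    refine (card_union_le _ _).trans ?_
    split_ifs with h2
    · rw [card_singleton]
      omega
    · rw [card_empty]
      omega
  obtain ⟨T, hT, hTD⟩ := pow_le_card_sequences (m := η * n) (by positivity)
    (fun k f u => ∀ d ∈ D k f, G.Adj d u) r fun k hk f => by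
      convert le_card_common_neighbors hη hr hδ hη0 (hD k hk f)
  refine ⟨T, hT, fun p hp => ?_⟩
  have hp' : ∀ k : Fin r, ∀ d ∈ D k fun j => p (Fin.castLE k.2.le j), G.Adj d (p k) := hTD p hp
  exact ⟨fun j => hp' j v (by simp [D]),
    fun i j hij => hp' j _ (mem_union_left _ (mem_insert_of_mem
      (mem_image.2 ⟨⟨i, hij⟩, mem_univ _, rfl⟩))),
    fun j hj => hp' j _ (mem_union_right _ (by simp [hj]))⟩

lemma le_card_isConnector {η : ℝ} (hη0 : 0 ≤ η) (hη : η ≤ 1) (hr : 2 ≤ r)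
    (hδ : ∀ v, (1 - 1 / (r : ℝ) + η) * n ≤ odeg G v) (e : Bool → Fin n) :
    (η * n) ^ (2 * r + 1) ≤
      (univ.filter fun f : Option (Bool × Fin r) → Fin n => IsConnector G e f).card := by
  have hm : 0 ≤ η * n := by positivity
  let W : Finset (Fin n) := univ.filter fun v => ∀ d ∈ univ.image e, G.Adj d v
  have hW : η * n ≤ W.card := by
    refine le_card_common_neighbors hη (by omega) hδ hη0 (card_image_le.trans ?_)
    simpa using hr
  choose T hT hTadj using fun v b => exists_family_cliques hη0 hη (by omega) hδ v (e b)
  calc (η * n) ^ (2 * r + 1) = (η * n) * ((η * n) ^ r * (η * n) ^ r) := by ring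
    _ ≤ W.card * ((η * n) ^ r * (η * n) ^ r) := by gcongr
    _ = W.card • ((η * n) ^ r * (η * n) ^ r) := (nsmul_eq_mul _ _).symm
    _ ≤ ∑ v ∈ W, ((Fintype.piFinset (T v)).card : ℝ) := by
        refine card_nsmul_le_sum _ _ _ fun v _ => ?_
        rw [Fintype.card_piFinset, Fintype.prod_bool]
        push_cast
        gcongr <;> exact hT _ _
    _ ≤ _ := by
        norm_cast
        rw [← card_sigma]
        refine card_le_card_of_injOn (fun p i => i.elim p.1 fun q => p.2 q.1 q.2) ?_ ?_
        · rintro ⟨v, q⟩ hp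
          simp only [coe_sigma, Set.mem_sigma_iff, mem_coe, Fintype.mem_piFinset, W, mem_filter,
            mem_univ, true_and, mem_image, forall_exists_index, forall_apply_eq_imp_iff] at hp ⊢
          obtain ⟨hv, hq⟩ := hp
          have hvq := fun b => (hTadj v b _ (hq b)).1
          have hqq := fun b => (hTadj v b _ (hq b)).2.1
          have hqe := fun b => (hTadj v b _ (hq b)).2.2
          intro b
          refine ⟨fun i => ?_, fun i => ?_⟩
          · refine Fin.cases (fun j => ?_) (fun i j => ?_) i
            · refine Fin.cases (fun h => absurd rfl h) (fun j _ => ?_) j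
              simpa [cliqueIndex] using hvq b j
            · refine Fin.cases (fun _ => ?_) (fun j hij => ?_) j
              · simpa [cliqueIndex] using (hvq b i).symm
              · have : i ≠ j := fun h => hij (by rw [h])
                rcases lt_or_gt_of_ne this with h | h
                · simpa [cliqueIndex] using hqq b i j h
                · simpa [cliqueIndex] using (hqq b j i h).symm
          · refine Fin.cases (fun _ => ?_) (fun i hi => ?_) i
            · simpa [cliqueIndex] using (hv b).symm
            · have : (i : ℕ) + 1 < r := by
                have h1 : (i : ℕ) + 1 ≠ r := fun h => hi (Fin.ext (by simpa using h))
                have := i.2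
                omega
              simpa [cliqueIndex] using (hqe b i this).symm
        · rintro ⟨v, q⟩ _ ⟨v', q'⟩ _ heq
          have h1 : v = v' := by simpa using congrFun heq none
          have h2 : q = q' := by
            funext b j
            simpa using congrFun heq (some (b, j))
          rw [h1, h2]

/-- A blow-up all of whose transversals have the same order pattern and pairwise adjacent
vertices in the positions given by `w` yields separated blocks. -/
lemma separated_of_pattern {ι : Type*} {t m : ℕ} [NeZero t] {e : Bool → Fin n}
    {S : Finset (ι → Fin n)} {F : ι × Fin t → Fin n}
    (hF : ∀ g : ι → Fin t, (fun i => F (i, g i)) ∈ S)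
    (hS : ∀ f ∈ S, ∀ f' ∈ S, ∀ i j, Sum.elim f e i < Sum.elim f e j →
      Sum.elim f' e i < Sum.elim f' e j)
    (w : Fin m → ι ⊕ Bool)
    (hw : ∀ f ∈ S, ∀ i j, i ≠ j → G.Adj (Sum.elim f e (w i)) (Sum.elim f e (w j))) :
    Separated G fun i =>
      Sum.elim (fun i => univ.image fun a => F (i, a)) (fun b => {e b}) (w i) := by
  intro i j hij
  have hne : w i ≠ w j := fun h => (hw _ (hF 0) i j hij).ne (by rw [h])
  have key : ∀ u ∈ Sum.elim (fun i => univ.image fun a => F (i, a)) (fun b => {e b}) (w i),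
      ∀ v ∈ Sum.elim (fun i => univ.image fun a => F (i, a)) (fun b => {e b}) (w j),
      ∃ f ∈ S, Sum.elim f e (w i) = u ∧ Sum.elim f e (w j) = v := by
    intro u hu v hv
    rcases hi : w i with i' | b <;> rcases hj : w j with j' | b' <;> rw [hi] at hu hne <;>
      rw [hj] at hv hne <;> simp only [Sum.elim_inl, Sum.elim_inr, mem_image, mem_univ, true_and,
        mem_singleton] at hu hv ⊢
    · obtain ⟨a, rfl⟩ := hu
      obtain ⟨a', rfl⟩ := hv
      have hne' : i' ≠ j' := fun h => hne (by rw [h])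
      exact ⟨_, hF (Function.update (fun _ => a) j' a'), by simp [hne'], by simp⟩
    · obtain ⟨a, rfl⟩ := hu
      exact ⟨_, hF fun _ => a, rfl, hv.symm⟩
    · obtain ⟨a, rfl⟩ := hv
      exact ⟨_, hF fun _ => a, hu.symm, rfl⟩
    · exact ⟨_, hF 0, hu.symm, hv.symm⟩
  rcases lt_or_gt_of_ne (hw _ (hF 0) i j hij).ne with hlt | hlt
  · left
    intro u hu v hv
    obtain ⟨f, hf, rfl, rfl⟩ := key u hu v hv
    exact ⟨hS _ (hF 0) f hf _ _ hlt, hw f hf i j hij⟩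
  · right
    intro u hu v hv
    obtain ⟨f, hf, rfl, rfl⟩ := key u hu v hv
    exact ⟨hS _ (hF 0) f hf _ _ hlt, hw f hf i j hij⟩

/-- The deterministic part of the argument: a blow-up of connectors with a common order pattern
contains a set connecting the two vertices. -/
lemma exists_connecting_set {s t : ℕ} (hr : 1 ≤ r) (hh : 1 ≤ h) {c : Fin h → Fin r}
    (hc : Monotone c) (hcol : ∀ i j, H.Adj i j → c i ≠ c j) (hsurj : Function.Surjective c)
    (hs : 2 * r + 2 ≤ s) (ht : s * h + 2 ≤ t) {e : Bool → Fin n}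
    {S : Finset (Option (Bool × Fin r) → Fin n)} (hconn : ∀ f ∈ S, IsConnector G e f)
    (hS : ∀ f ∈ S, ∀ f' ∈ S, ∀ i j, Sum.elim f e i < Sum.elim f e j →
      Sum.elim f' e i < Sum.elim f' e j)
    {F : Option (Bool × Fin r) × Fin t → Fin n} (hFinj : Function.Injective F)
    (hF : ∀ g : Option (Bool × Fin r) → Fin t, (fun i => F (i, g i)) ∈ S) :
    ∃ X ⊆ univ.image F, e false ∉ X ∧ e true ∉ X ∧ X.card = s * h - 1 ∧
      HasPerfectTilingOn H G (insert (e false) X) ∧ HasPerfectTilingOn H G (insert (e true) X) := by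
  have : NeZero t := ⟨by omega⟩
  let B : Option (Bool × Fin r) → Finset (Fin n) := fun i => univ.image fun a => F (i, a)
  have hBU : ∀ i, B i ⊆ univ.image F := fun i u hu => by
    obtain ⟨a, -, rfl⟩ := mem_image.1 hu
    exact mem_image_of_mem _ (mem_univ _)
  have hBcard : ∀ i, s * h + 2 ≤ (B i).card := fun i => by
    rw [card_image_of_injective _ fun a b hab => (Prod.ext_iff.1 (hFinj hab)).2]
    simpa using ht
  have hsep : ∀ b, Separated G fun i => B (cliqueIndex b i) := fun b =>
    separated_of_pattern hF hS (fun i => Sum.inl (cliqueIndex b i))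
      fun f hf => (hconn f hf b).1
  have hsep' : ∀ b, Separated G
      (Function.update (fun i => B (cliqueIndex b i)) (Fin.last r) {e b}) := fun b => by
    have := separated_of_pattern (G := G) hF hS
      (Function.update (fun i => Sum.inl (cliqueIndex b i)) (Fin.last r) (Sum.inr b)) ?_
    · convert this using 1
      funext i
      by_cases hi : i = Fin.last r
      · subst hi
        simp
      · simp [hi, B]
    · intro f hf i j hij
      by_cases hi : i = Fin.last r
      · subst hi
        simpa [hij.symm] using ((hconn f hf b).2 j hij.symm).symm
      · by_cases hj : j = Fin.last r
        · subst hj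
          simpa [hi] using (hconn f hf b).2 i hi
        · simpa [hi, hj] using (hconn f hf b).1 i j hij
  have hlink : ∀ b k, r ≤ k → ∀ z ∈ B none, Linked H G (univ.image F) (s * h) (k + 1) (e b) z :=
    fun b k hk z hz => linked_of_separated hr hh hc hcol hsurj (hsep b) (hsep' b)
      (fun _ => hBU _) (fun _ => hBcard _) hk (i := 0) (by simpa [cliqueIndex] using hz)
  have hfin := Linked.trans (a := r + 1) (b := s - r - 2 + 1) (by omega) (by omega) hh
    (hBU none) (hBcard none) (hlink false r le_rfl)
    fun z hz => (hlink true (s - r - 2) (by omega) z hz).symm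
  rw [show r + 1 + (s - r - 2 + 1) = s by omega] at hfin
  obtain ⟨X, hXU, -, hx, hy, hcard, h1, h2⟩ := hfin ∅ (by simp)
  exact ⟨X, hXU, hx, hy, by omega, h1, h2⟩

/-- Pigeonhole: a positive proportion of a family of functions has the same order pattern. -/
lemma exists_subset_same_pattern {ι : Type*} [Fintype ι] (e : Bool → Fin n)
    (S : Finset (ι → Fin n)) :
    ∃ S' ⊆ S, (∀ f ∈ S', ∀ f' ∈ S', ∀ i j, Sum.elim f e i < Sum.elim f e j →
        Sum.elim f' e i < Sum.elim f' e j) ∧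
      (S.card : ℝ) / Nat.card (ι ⊕ Bool → ι ⊕ Bool → Prop) ≤ S'.card := by
  obtain ⟨π, -, hπ⟩ := exists_le_card_fiber_of_nsmul_le_card_of_maps_to (s := S)
    (t := (univ : Finset (ι ⊕ Bool → ι ⊕ Bool → Prop)))
    (f := fun f i j => Sum.elim f e i < Sum.elim f e j)
    (b := (S.card : ℝ) / Nat.card (ι ⊕ Bool → ι ⊕ Bool → Prop))
    (fun _ _ => mem_univ _) univ_nonempty (by
      rw [card_univ, ← Nat.card_eq_fintype_card, nsmul_eq_mul, mul_div_cancel₀]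
      exact_mod_cast Nat.card_pos.ne')
  refine ⟨_, filter_subset _ _, fun f hf f' hf' i j hij => ?_, hπ⟩
  rw [mem_filter] at hf hf'
  have := congrFun (congrFun (hf.2.trans hf'.2.symm) i) j
  exact this ▸ hij

end Connectors

section Main

open Classical

/-- If a dense family of functions is such that the range of each injective member contains a set
from `𝒳`, a family of `q`-sets, then `𝒳` is dense as well. -/
lemma mul_pow_le_card_of_dense {α V : Type*} [Fintype α] [Fintype V] [Nonempty V] [LinearOrder V]
    {𝓑 : Finset (α → V)} {𝒳 : Finset (Finset V)} {q : ℕ} (hqα : q ≤ Fintype.card α)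
    (hq : ∀ X ∈ 𝒳, X.card = q) {c : ℝ} (hc : 0 < c)
    (h𝓑 : c * (Fintype.card V : ℝ) ^ Fintype.card α ≤ 𝓑.card)
    (hV : 2 * (Fintype.card α : ℝ) ^ 2 / c ≤ Fintype.card V)
    (h𝓑𝒳 : ∀ F ∈ 𝓑, Function.Injective F → ∃ X ∈ 𝒳, X ⊆ univ.image F) :
    c / 2 / ((Fintype.card α : ℝ) ^ q + 1) * (Fintype.card V : ℝ) ^ q ≤ 𝒳.card := by
  have hn : (0 : ℝ) < Fintype.card V := by exact_mod_cast Fintype.card_pos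
  set m : ℝ := (Fintype.card V : ℝ)
  set N := Fintype.card α
  have hnon : ((𝓑.filter fun F => ¬ Function.Injective F).card : ℝ) ≤
      c / 2 * m ^ N := by
    refine le_of_mul_le_mul_right ((card_mul_le_of_not_injective fun F hF =>
      (mem_filter.1 hF).2).trans ?_) hn
    rw [div_le_iff₀ hc] at hV
    calc (N : ℝ) ^ 2 * m ^ N ≤ (m * c / 2) * m ^ N := by
          gcongr
          linarith
      _ = _ := by ring
  have hsplit : (𝓑.card : ℝ) = (𝓑.filter Function.Injective).card +
      (𝓑.filter fun F => ¬ Function.Injective F).card := by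
    exact_mod_cast (card_filter_add_card_filter_not (s := 𝓑) Function.Injective).symm
  have hcount : ((𝓑.filter Function.Injective).card : ℝ) ≤
      (N : ℝ) ^ q * (𝒳.card * m ^ (N - q)) := by
    have := (Nat.cast_le (α := ℝ)).2 (card_le_of_forall_exists_subset_range
      (𝓑.filter Function.Injective) 𝒳 hq
      fun F hF => h𝓑𝒳 F (mem_filter.1 hF).1 (mem_filter.1 hF).2)
    push_cast at this
    exact this
  have hpow : m ^ N = m ^ q * m ^ (N - q) := by rw [← pow_add, Nat.add_sub_cancel' hqα]
  rw [div_mul_eq_mul_div, div_le_iff₀ (by positivity)]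
  refine le_of_mul_le_mul_right ?_ (show 0 < m ^ (N - q) by positivity)
  calc c / 2 * m ^ q * m ^ (N - q) = c * m ^ N - c / 2 * m ^ N := by rw [hpow]; ring
    _ ≤ (N : ℝ) ^ q * (𝒳.card * m ^ (N - q)) := by linarith
    _ ≤ 𝒳.card * ((N : ℝ) ^ q + 1) * m ^ (N - q) := by
      have : 0 ≤ 𝒳.card * m ^ (N - q) := by positivity
      nlinarith

lemma exists_many_connecting_sets {h r s : ℕ} {H : SimpleGraph (Fin h)} (hr : 2 ≤ r) (hh : 1 ≤ h)
    {c : Fin h → Fin r} (hc : Monotone c) (hcol : ∀ i j, H.Adj i j → c i ≠ c j)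
    (hsurj : Function.Surjective c) (hs : 2 * r + 2 ≤ s) {η : ℝ} (hη0 : 0 < η) (hη : η ≤ 1) :
    ∃ (n₀ : ℕ) (ξ : ℝ), 0 < ξ ∧ ∀ n : ℕ, n₀ ≤ n → ∀ G : SimpleGraph (Fin n),
      (∀ v, (1 - 1 / (r : ℝ) + η) * n ≤ odeg G v) → ∀ x y : Fin n,
        ξ * (n : ℝ) ^ (s * h - 1) ≤ (univ.filter fun X : Finset (Fin n) =>
          x ∉ X ∧ y ∉ X ∧ X.card = s * h - 1 ∧
            HasPerfectTilingOn H G (insert x X) ∧ HasPerfectTilingOn H G (insert y X)).card := by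
  let ι := Option (Bool × Fin r)
  have hι : Fintype.card ι = 2 * r + 1 := by simp [ι]
  let K := Nat.card (ι ⊕ Bool → ι ⊕ Bool → Prop)
  have hK : 0 < K := Nat.card_pos
  let α := ι × Fin (s * h + 2)
  have hα : Fintype.card α = (s * h + 2) * Fintype.card ι := by
    rw [Fintype.card_prod, Fintype.card_fin, mul_comm]
  have hqα : s * h - 1 ≤ Fintype.card α := by
    rw [hα, hι]
    nlinarith [Nat.sub_le (s * h) 1, Nat.zero_le (s * h * r)]
  let d : ℝ := (η ^ Fintype.card ι / K) ^ (s * h + 2) ^ Fintype.card ι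
  have hd : 0 < d := by positivity
  refine ⟨⌈2 * (Fintype.card α : ℝ) ^ 2 / d⌉₊, d / 2 / ((Fintype.card α : ℝ) ^ (s * h - 1) + 1),
    by positivity, fun n hn G hδ x y => ?_⟩
  have : Nonempty (Fin n) := ⟨x⟩
  let e : Bool → Fin n := fun b => if b then y else x
  obtain ⟨S, hSconn, hSpat, hScard⟩ := exists_subset_same_pattern e
    (univ.filter fun f : ι → Fin n => IsConnector G e f)
  have hcount : η ^ Fintype.card ι / K * (Fintype.card (Fin n) : ℝ) ^ Fintype.card ι ≤ S.card := by
    refine le_trans ?_ hScard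
    rw [div_mul_eq_mul_div, ← mul_pow, hι, Fintype.card_fin]
    gcongr
    exact le_card_isConnector hη0.le hη hr hδ e
  obtain ⟨𝓑, hblow, h𝓑⟩ := exists_blowup_family (t := s * h + 2) (S := S) (by positivity) hcount
  rw [← hα] at hblow
  have := mul_pow_le_card_of_dense (𝒳 := univ.filter fun X : Finset (Fin n) =>
    x ∉ X ∧ y ∉ X ∧ X.card = s * h - 1 ∧
      HasPerfectTilingOn H G (insert x X) ∧ HasPerfectTilingOn H G (insert y X))
    hqα (fun X hX => (mem_filter.1 hX).2.2.2.1) hd hblow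
    (by rw [Fintype.card_fin]; exact Nat.ceil_le.1 hn) fun F hF hFinj => by
      obtain ⟨X, hXF, hX⟩ := exists_connecting_set (by omega) hh hc hcol hsurj hs le_rfl
        (fun f hf => (mem_filter.1 (hSconn hf)).2) hSpat hFinj (h𝓑 F hF)
      exact ⟨X, mem_filter.2 ⟨mem_univ _, by simpa [e] using hX⟩, hXF⟩
  rwa [Fintype.card_fin] at this

end Main

theorem connecting_lemma_tilings (h : ℕ) :
    ∃ η₀ : ℝ, 0 < η₀ ∧
      ∀ H : SimpleGraph (Fin h), (∃ a b : Fin h, H.Adj a b) →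
      ∀ η : ℝ, 0 < η → η ≤ η₀ →
      ∃ (n₀ : ℕ) (ξ : ℝ), 0 < ξ ∧ ∀ n : ℕ, n₀ ≤ n → ∀ G : SimpleGraph (Fin n),
        (∀ v : Fin n, (1 - 1 / (intervalChi H : ℝ) + η) * n ≤ (odeg G v : ℝ)) →
        ∀ x y : Fin n,
          ξ * (n : ℝ) ^ (⌈(32 : ℝ) / η⌉₊ * h - 1) ≤
            ({X : Finset (Fin n) | x ∉ X ∧ y ∉ X ∧ X.card = ⌈(32 : ℝ) / η⌉₊ * h - 1 ∧
              HasPerfectTilingOn H G (insert x X) ∧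
              HasPerfectTilingOn H G (insert y X)}.ncard : ℝ) := by
  classical
  refine ⟨1 / (h + 1), by positivity, fun H hH η hη0 hη => ?_⟩
  have hr := two_le_intervalChi hH
  have hrh := intervalChi_le H
  obtain ⟨c, hc, hcol⟩ := hasIntervalColoring_intervalChi H
  have hη1 : η ≤ 1 := hη.trans (by
    rw [div_le_one (by positivity)]
    linarith [(Nat.cast_nonneg h : (0 : ℝ) ≤ h)])
  have hs : 2 * intervalChi H + 2 ≤ ⌈(32 : ℝ) / η⌉₊ := by
    have h1 : (32 : ℝ) * (h + 1) ≤ 32 / η := by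
      rw [le_div_iff₀ hη0]
      rw [le_div_iff₀ (by positivity)] at hη
      linarith
    have h2 : (32 * (h + 1) : ℕ) ≤ ⌈(32 : ℝ) / η⌉₊ := by
      exact_mod_cast h1.trans (Nat.le_ceil _)
    omega
  obtain ⟨n₀, ξ, hξ, hmain⟩ := exists_many_connecting_sets hr (by omega) hc hcol
    (surjective_of_intervalChi hc hcol) hs hη0 hη1
  refine ⟨n₀, ξ, hξ, fun n hn G hδ x y => (hmain n hn G hδ x y).trans_eq ?_⟩
  rw [← Set.ncard_coe_finset]
  simp
end

section
/- Let H be an ordered graph on h vertices with interval chromatic number χ<(H)=2 satisfying: (i) the vertices 1, ⌈h/2⌉ and h are isolated in H; (ii) every edge of H lies between the intervals [2, ⌈h/2⌉−1] and [⌈h/2⌉+1, h−1]. Let 0<η<1. Then there exist n₀∈ℕ and ξ>0 such that the following holds: if G is an ordered graph on vertex set [n] with n ≥ n₀ and minimum degree δ(G) ≥ ηn, then for every pair x,y ∈ [n] there are at least ξn^{h−1} sets X ⊆ [n]∖{x,y} of size h−1 such that both G[X∪{x}] and G[X∪{y}] contain spanning copies of H. -/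
open Finset

theorem mul_card_le_sum_pow {ι : Type*} [Fintype ι] (f : ι → ℝ) (hf : ∀ i, 0 ≤ f i) {a : ℝ}
    (ha : 0 ≤ a) (h : a * Fintype.card ι ≤ ∑ i, f i) (k : ℕ) :
    a ^ k * Fintype.card ι ≤ ∑ i, f i ^ k := by
  rcases k with _ | k
  · simp
  rcases Nat.eq_zero_or_pos (Fintype.card ι) with h0 | h0
  · rw [h0]
    simpa using Finset.sum_nonneg fun i _ => pow_nonneg (hf i) _
  have hN : (0 : ℝ) < Fintype.card ι := by exact_mod_cast h0
  have h1 := pow_sum_div_card_le_sum_pow (s := Finset.univ) (f := f) (fun i _ => hf i) k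
  refine le_trans ?_ h1
  rw [Finset.card_univ, le_div_iff₀ (by positivity)]
  calc a ^ (k + 1) * (Fintype.card ι : ℝ) * (Fintype.card ι : ℝ) ^ k
      = (a * Fintype.card ι) ^ (k + 1) := by ring
    _ ≤ _ := by gcongr

open Classical in
/-- Supersaturation: a relation of density `c` contains at least the random number of
homomorphic copies of the complete bipartite graph `K_{s,t}`. -/
theorem card_biclique_maps_ge {V : Type*} [Fintype V] (R : V → V → Prop) (s t : ℕ)
    {c : ℝ} (hc : 0 ≤ c)
    (hE : c * (Fintype.card V : ℝ) ^ 2 ≤ (#{p : V × V | R p.1 p.2} : ℝ)) :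
    c ^ (s * t) * (Fintype.card V : ℝ) ^ (s + t) ≤
      (#{F : Fin s ⊕ Fin t → V | ∀ i j, R (F (Sum.inl i)) (F (Sum.inr j))} : ℝ) := by
  have e1 : #{p : V × V | R p.1 p.2} = ∑ b : V, #{a : V | R a b} := by
    simp only [Finset.card_filter, Fintype.sum_prod_type_right]
  have e2 : ∑ b : V, #{a : V | R a b} ^ s = ∑ f : Fin s → V, #{b : V | ∀ i, R (f i) b} := by
    have : ∀ b : V, #{a : V | R a b} ^ s = #{f : Fin s → V | ∀ i, R (f i) b} := by
      intro b
      rw [← Fintype.card_piFinset_const]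
      congr 1
      ext f
      simp
    rw [Finset.sum_congr rfl fun b _ => this b]
    simp only [Finset.card_filter]
    exact Finset.sum_comm
  have e3 : #{F : Fin s ⊕ Fin t → V | ∀ i j, R (F (Sum.inl i)) (F (Sum.inr j))} =
      ∑ f : Fin s → V, #{b : V | ∀ i, R (f i) b} ^ t := by
    have : ∀ f : Fin s → V, #{b : V | ∀ i, R (f i) b} ^ t =
        #{g : Fin t → V | ∀ i j, R (f i) (g j)} := by
      intro f
      rw [← Fintype.card_piFinset_const]
      congr 1
      ext f
      simp only [Fintype.mem_piFinset, Finset.mem_filter, Finset.mem_univ, true_and]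
      exact forall_comm
    rw [Finset.sum_congr rfl fun f _ => this f]
    simp only [Finset.card_filter]
    rw [← Fintype.sum_prod_type', ← (Equiv.sumArrowEquivProdArrow (Fin s) (Fin t) V).sum_comp]
    rfl
  have h1 := mul_card_le_sum_pow (fun b : V => (#{a : V | R a b} : ℝ)) (fun _ => by positivity)
    (a := c * Fintype.card V) (by positivity)
    (by rw [e1] at hE; push_cast at hE; linarith [hE]) s
  have h2 := mul_card_le_sum_pow (fun f : Fin s → V => (#{b : V | ∀ i, R (f i) b} : ℝ))
    (fun _ => by positivity) (a := c ^ s * Fintype.card V) (by positivity)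
    (by
      have e2' : ∑ b : V, (#{a : V | R a b} : ℝ) ^ s =
        ∑ f : Fin s → V, (#{b : V | ∀ i, R (f i) b} : ℝ) := by exact_mod_cast e2
      rw [← e2']
      refine le_trans (le_of_eq ?_) h1
      simp
      ring) t
  rw [e3]
  push_cast
  refine le_trans (le_of_eq ?_) h2
  simp
  ring

open Classical in
theorem card_not_injective_le {α V : Type*} [Fintype α] [Fintype V] :
    #{F : α → V | ¬ Function.Injective F} ≤
      Fintype.card α ^ 2 * Fintype.card V ^ (Fintype.card α - 1) := by
  have hsub : ({F : α → V | ¬ Function.Injective F} : Finset (α → V)) ⊆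
      ({p : α × α | p.1 ≠ p.2} : Finset (α × α)).biUnion
        fun p => {F : α → V | F p.1 = F p.2} := by
    intro F hF
    rw [Finset.mem_filter, Function.not_injective_iff] at hF
    obtain ⟨-, a, b, h1, h2⟩ := hF
    simp only [Finset.mem_biUnion, Finset.mem_filter, Finset.mem_univ, true_and]
    exact ⟨(a, b), h2, h1⟩
  refine (Finset.card_le_card hsub).trans ?_
  refine (Finset.card_biUnion_le_card_mul _ _ (Fintype.card V ^ (Fintype.card α - 1)) ?_).trans ?_
  · rintro ⟨a, b⟩ hab
    simp only [Finset.mem_filter, Finset.mem_univ, true_and] at hab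
    have hcard : Fintype.card ({l : α // l ≠ b} → V) =
        Fintype.card V ^ (Fintype.card α - 1) := by
      rw [Fintype.card_fun, Fintype.card_subtype_compl, Fintype.card_subtype_eq]
    rw [← hcard, ← Finset.card_univ]
    refine Finset.card_le_card_of_injOn (fun F l => F l) (fun _ _ => by simp) ?_
    intro F hF F' hF' hFF
    simp only [Finset.coe_filter, Finset.mem_univ, true_and, Set.mem_ofPred_eq] at hF hF'
    have key : ∀ l, l ≠ b → F l = F' l := fun l hl => congrFun hFF ⟨l, hl⟩
    funext l
    by_cases hl : l = b
    · subst hl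
      rw [← hF, ← hF', key a hab]
    · exact key l hl
  · refine Nat.mul_le_mul_right _ ((Finset.card_le_univ _).trans ?_)
    rw [Fintype.card_prod, sq]

open Classical in
theorem exists_many_injective_biclique_maps {V : Type*} [Fintype V] (R : V → V → Prop) {s t : ℕ}
    (hst : 0 < s + t) {c : ℝ} (hc : 0 < c)
    (hV : 2 * ((s + t : ℕ) : ℝ) ^ 2 ≤ c ^ (s * t) * (Fintype.card V : ℝ))
    (hE : c * (Fintype.card V : ℝ) ^ 2 ≤ (#{p : V × V | R p.1 p.2} : ℝ)) :
    ∃ B : Finset (Fin s ⊕ Fin t → V),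
      (∀ F ∈ B, Function.Injective F ∧ ∀ i j, R (F (Sum.inl i)) (F (Sum.inr j))) ∧
      c ^ (s * t) / 2 * (Fintype.card V : ℝ) ^ (s + t) ≤ (#B : ℝ) := by
  set A : Finset (Fin s ⊕ Fin t → V) :=
    {F | ∀ i j, R (F (Sum.inl i)) (F (Sum.inr j))} with hA
  have hAcard : c ^ (s * t) * (Fintype.card V : ℝ) ^ (s + t) ≤ (#A : ℝ) := by
    convert card_biclique_maps_ge R s t hc.le hE
  refine ⟨A.filter Function.Injective, fun F hF =>
    ⟨(Finset.mem_filter.1 hF).2, by simpa [hA] using (Finset.mem_filter.1 hF).1⟩, ?_⟩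
  have h1 := Finset.card_filter_add_card_filter_not (s := A) Function.Injective
  have h2 : #(A.filter fun F => ¬ Function.Injective F) ≤
      (s + t) ^ 2 * Fintype.card V ^ (s + t - 1) := by
    have h3 := card_not_injective_le (α := Fin s ⊕ Fin t) (V := V)
    rw [Fintype.card_sum, Fintype.card_fin, Fintype.card_fin] at h3
    refine le_trans (Finset.card_le_card fun F hF => ?_) h3
    simpa using (Finset.mem_filter.1 hF).2
  have h4 : (#A : ℝ) ≤ #(A.filter Function.Injective) +
      ((s + t : ℕ) : ℝ) ^ 2 * (Fintype.card V : ℝ) ^ (s + t - 1) := by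
    have : #A ≤ #(A.filter Function.Injective) +
      (s + t) ^ 2 * Fintype.card V ^ (s + t - 1) := by omega
    exact_mod_cast this
  have h5 : ((s + t : ℕ) : ℝ) ^ 2 * (Fintype.card V : ℝ) ^ (s + t - 1) ≤
      c ^ (s * t) / 2 * (Fintype.card V : ℝ) ^ (s + t) := by
    obtain ⟨m, hm⟩ : ∃ m, s + t = m + 1 := ⟨s + t - 1, by omega⟩
    rw [hm] at hV ⊢
    rw [Nat.add_sub_cancel, pow_succ (Fintype.card V : ℝ) m]
    have : (0 : ℝ) ≤ (Fintype.card V : ℝ) ^ m := by positivity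
    nlinarith
  linarith

theorem card_le_mul_card_image_ranges {α V : Type*} [Fintype α] [DecidableEq α] [DecidableEq V]
    (B : Finset (α → V)) :
    #B ≤ Fintype.card α ^ Fintype.card α * #(B.image fun F => Finset.univ.image F) := by
  refine Finset.card_le_mul_card_image _ _ fun X hX => ?_
  obtain ⟨F₀, -, rfl⟩ := Finset.mem_image.1 hX
  calc _ ≤ #(Fintype.piFinset fun _ : α => Finset.univ.image F₀) := by
        refine Finset.card_le_card fun F hF => ?_
        rw [Fintype.mem_piFinset]
        intro i
        rw [← (Finset.mem_filter.1 hF).2]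
        exact Finset.mem_image_of_mem _ (Finset.mem_univ i)
    _ = #(Finset.univ.image F₀) ^ Fintype.card α := by
        rw [Fintype.card_piFinset, Finset.prod_const, Finset.card_univ]
    _ ≤ Fintype.card α ^ Fintype.card α := Nat.pow_le_pow_left Finset.card_image_le _

/-- If `P` and `Q` are completely joined, `P` precedes `Q`, and `z` splits neither `P` nor `Q`,
then `P ∪ Q ∪ {z}` spans a copy of `H`. -/
theorem isCopySet_insert_union {h n s : ℕ} {H : SimpleGraph (Fin h)} {G : SimpleGraph (Fin n)}
    (hloc : ∀ a b : Fin h, H.Adj a b → a < b →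
      1 ≤ (a : ℕ) ∧ (a : ℕ) < s ∧ s < (b : ℕ) ∧ (b : ℕ) + 1 < h)
    {P Q : Finset (Fin n)} {z : Fin n} (hP : P.card = s)
    (hcard : (insert z (P ∪ Q)).card = h)
    (hPQ : ∀ a ∈ P, ∀ b ∈ Q, a < b ∧ G.Adj a b)
    (hzP : (∀ a ∈ P, z < a) ∨ ∀ a ∈ P, a < z)
    (hzQ : (∀ b ∈ Q, z < b) ∨ ∀ b ∈ Q, b < z) :
    IsCopySet H G (insert z (P ∪ Q)) := by
  set S := insert z (P ∪ Q) with hS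
  have hSmem : ∀ v, v ∈ S → v = z ∨ v ∈ P ∨ v ∈ Q := fun v hv => by
    rwa [hS, Finset.mem_insert, Finset.mem_union] at hv
  have hrank : ∀ i : Fin h, #{v ∈ S | v < S.orderEmbOfFin hcard i} = (i : ℕ) := by
    intro i
    have : {v ∈ S | v < S.orderEmbOfFin hcard i} =
        (Finset.Iio i).map (S.orderEmbOfFin hcard).toEmbedding := by
      ext v
      simp only [Finset.mem_filter, Finset.mem_map, Finset.mem_Iio]
      constructor
      · rintro ⟨hv, hlt⟩
        have hv' : v ∈ Set.range (S.orderEmbOfFin hcard) := by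
          rw [Finset.range_orderEmbOfFin]; exact hv
        obtain ⟨k, rfl⟩ := hv'
        exact ⟨k, (S.orderEmbOfFin hcard).lt_iff_lt.1 hlt, rfl⟩
      · rintro ⟨k, hk, rfl⟩
        exact ⟨S.orderEmbOfFin_mem hcard k, (S.orderEmbOfFin hcard).lt_iff_lt.2 hk⟩
    rw [this, Finset.card_map, Fin.card_Iio]
  have hmem := fun i : Fin h => hSmem _ (S.orderEmbOfFin_mem hcard i)
  have hge : ∀ i : Fin h, (∀ a ∈ P, a < S.orderEmbOfFin hcard i) → s ≤ (i : ℕ) := by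
    intro i hi
    rw [← hrank i, ← hP]
    refine Finset.card_le_card fun a ha => ?_
    simp only [Finset.mem_filter]
    exact ⟨by simp [hS, ha], hi a ha⟩
  have hedge : ∀ i j : Fin h, i < j → H.Adj i j →
      G.Adj (S.orderEmbOfFin hcard i) (S.orderEmbOfFin hcard j) := by
    intro i j hij hadj
    obtain ⟨h1, h2, h3, h4⟩ := hloc i j hadj hij
    have hiP : S.orderEmbOfFin hcard i ∈ P := by
      rcases hmem i with hz | hiP | hiQ
      · rcases hzP with hzP | hzP
        · exfalso
          have hPne : P.Nonempty := by
            rw [← Finset.card_pos]; omega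
          obtain ⟨p, hp⟩ := hPne
          have h0 : #{v ∈ S | v < S.orderEmbOfFin hcard i} = 0 := by
            rw [Finset.card_eq_zero, Finset.filter_eq_empty_iff]
            intro v hv hlt
            rw [hz] at hlt
            rcases hSmem v hv with rfl | hv | hv
            · exact lt_irrefl _ hlt
            · exact lt_asymm hlt (hzP v hv)
            · exact lt_asymm hlt ((hzP p hp).trans (hPQ p hp v hv).1)
          rw [hrank] at h0
          omega
        · have := hge i (by rw [hz]; exact hzP)
          omega
      · exact hiP
      · have := hge i (fun a ha => (hPQ a ha _ hiQ).1)
        omega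
    have hjQ : S.orderEmbOfFin hcard j ∈ Q := by
      rcases hmem j with hz | hjP | hjQ
      · exfalso
        rcases hzQ with hzQ | hzQ
        · have : #{v ∈ S | v < S.orderEmbOfFin hcard j} ≤ P.card := by
            refine Finset.card_le_card fun v hv => ?_
            rw [Finset.mem_filter, hz] at hv
            obtain ⟨hvS, hlt⟩ := hv
            rcases hSmem v hvS with rfl | hv | hv
            · exact absurd hlt (lt_irrefl _)
            · exact hv
            · exact absurd hlt (lt_asymm (hzQ v hv))
          rw [hrank] at this
          omega
        · have hlast : ∀ v ∈ S, v ≤ S.orderEmbOfFin hcard j := by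
            intro v hv
            have hzi : S.orderEmbOfFin hcard i < z := by
              rw [← hz]; exact (S.orderEmbOfFin hcard).lt_iff_lt.2 hij
            rw [hz]
            rcases hSmem v hv with rfl | hv | hv
            · exact le_rfl
            · rcases hzP with hzP | hzP
              · exact absurd hzi (lt_asymm (hzP _ hiP))
              · exact (hzP v hv).le
            · exact (hzQ v hv).le
          have := (S.orderEmbOfFin hcard).le_iff_le.1
            (hlast _ (S.orderEmbOfFin_mem hcard ⟨j + 1, h4⟩))
          rw [Fin.le_def] at this
          simp at this
      · exfalso
        have : #{v ∈ S | v < S.orderEmbOfFin hcard j} ≤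
            (insert z (P.erase (S.orderEmbOfFin hcard j))).card := by
          refine Finset.card_le_card fun v hv => ?_
          obtain ⟨hvS, hlt⟩ := Finset.mem_filter.1 hv
          rcases hSmem v hvS with rfl | hv | hv
          · exact Finset.mem_insert_self _ _
          · exact Finset.mem_insert_of_mem (Finset.mem_erase.2 ⟨hlt.ne, hv⟩)
          · exact absurd hlt (lt_asymm (hPQ _ hjP v hv).1)
        have h5 := Finset.card_insert_le z (P.erase (S.orderEmbOfFin hcard j))
        rw [Finset.card_erase_of_mem hjP] at h5
        rw [hrank] at this
        omega
      · exact hjQ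
    exact (hPQ _ hiP _ hjQ).2
  refine ⟨S.orderEmbOfFin hcard, ⟨(S.orderEmbOfFin hcard).strictMono, ?_⟩, ?_⟩
  · intro i j hadj
    rcases lt_trichotomy i j with hij | rfl | hij
    · exact hedge i j hij hadj
    · exact absurd hadj (H.loopless.irrefl i)
    · exact (hedge j i hij hadj.symm).symm
  · exact Finset.image_orderEmbOfFin_univ S hcard

open Classical in
theorem card_block_le {n : ℕ} (L k : ℕ) (hL : 0 < L) :
    #{v : Fin n | (v : ℕ) / L = k} ≤ L := by
  calc #{v : Fin n | (v : ℕ) / L = k}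
      ≤ #(Finset.Ico (k * L) (k * L + L)) := by
        refine Finset.card_le_card_of_injOn (fun v => (v : ℕ)) ?_ Fin.val_injective.injOn
        intro v hv
        simp only [Finset.coe_filter, Finset.mem_univ, true_and, Set.mem_ofPred_eq] at hv
        rw [Nat.div_eq_iff hL] at hv
        simp only [Finset.coe_Ico, Set.mem_Ico]
        omega
    _ = L := by simp

open Classical in
/-- A graph of linear minimum degree, cut into linearly long blocks, has two blocks avoiding
`x` and `y` with positive density between them. -/
theorem exists_dense_blocks {η : ℝ} (hη : 0 < η) :
    ∃ (n₀ : ℕ) (c : ℝ), 0 < c ∧ ∀ n : ℕ, n₀ ≤ n → ∀ G : SimpleGraph (Fin n),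
      (∀ v : Fin n, η * n ≤ (odeg G v : ℝ)) → ∀ x y : Fin n, ∃ L I J : ℕ, I < J ∧
        (x : ℕ) / L ≠ I ∧ (x : ℕ) / L ≠ J ∧ (y : ℕ) / L ≠ I ∧ (y : ℕ) / L ≠ J ∧
        c * (n : ℝ) ^ 2 ≤ (#{p : Fin n × Fin n |
          (p.1 : ℕ) / L = I ∧ (p.2 : ℕ) / L = J ∧ G.Adj p.1 p.2} : ℝ) := by
  set K := ⌈20 / η⌉₊ with hK
  have hK0 : 0 < K := Nat.ceil_pos.2 (by positivity)
  have hKr : (0 : ℝ) < K := by exact_mod_cast hK0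
  refine ⟨K, η / (2 * K ^ 2), by positivity, ?_⟩
  intro n hn G hdeg x y
  have hn0 : 0 < n := x.pos
  have hnr : (0 : ℝ) < n := by exact_mod_cast hn0
  set L := ⌈η / 20 * n⌉₊ with hL
  have hL0 : 0 < L := Nat.ceil_pos.2 (by positivity)
  have hKge : 20 / η ≤ K := Nat.le_ceil _
  have hLge : η / 20 * n ≤ L := Nat.le_ceil _
  have hLle : (L : ℝ) ≤ η / 10 * n := by
    have h1 : (L : ℝ) < η / 20 * n + 1 := Nat.ceil_lt_add_one (by positivity)
    have h2 : (K : ℝ) ≤ n := by exact_mod_cast hn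
    have h3 : 1 ≤ η / 20 * n := by
      have := hKge.trans h2
      rw [div_le_iff₀ hη] at this
      linarith
    linarith
  have hblk : ∀ v : Fin n, (v : ℕ) / L < K := by
    intro v
    rw [Nat.div_lt_iff_lt_mul hL0]
    refine v.2.trans_le ?_
    have : (n : ℝ) ≤ K * L := by
      calc (n : ℝ) = 20 / η * (η / 20 * n) := by field_simp
        _ ≤ K * L := by gcongr
    exact_mod_cast this
  set T : Finset (Fin n × Fin n) := {p | G.Adj p.1 p.2} with hT
  have hTcard : η * n ^ 2 ≤ (#T : ℝ) := by
    have e1 : #T = ∑ v, odeg G v := by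
      simp only [hT, Finset.card_filter, Fintype.sum_prod_type]
      refine Finset.sum_congr rfl fun v _ => ?_
      rw [← Finset.card_filter, odeg, ← Set.ncard_coe_finset]
      congr 1
      ext w
      simp
    rw [e1]
    push_cast
    calc η * (n : ℝ) ^ 2 = ∑ _v : Fin n, η * n := by simp; ring
      _ ≤ _ := Finset.sum_le_sum fun v _ => hdeg v
  set good : Fin n × Fin n → Prop := fun p => (p.1 : ℕ) / L ≠ (p.2 : ℕ) / L ∧
    (x : ℕ) / L ≠ (p.1 : ℕ) / L ∧ (x : ℕ) / L ≠ (p.2 : ℕ) / L ∧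
    (y : ℕ) / L ≠ (p.1 : ℕ) / L ∧ (y : ℕ) / L ≠ (p.2 : ℕ) / L with hgood
  have hfst : ∀ k : ℕ, #{p : Fin n × Fin n | (p.1 : ℕ) / L = k} ≤ n * L := by
    intro k
    rw [Finset.card_filter, Fintype.sum_prod_type_right]
    simp only [← Finset.card_filter]
    refine (Finset.sum_le_card_nsmul _ _ L fun v _ => card_block_le L k hL0).trans ?_
    simp
  have hsnd : ∀ f : Fin n → ℕ, #{p : Fin n × Fin n | (p.2 : ℕ) / L = f p.1} ≤ n * L := by
    intro f
    rw [Finset.card_filter, Fintype.sum_prod_type]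
    simp only [← Finset.card_filter]
    refine (Finset.sum_le_card_nsmul _ _ L fun v _ => card_block_le L (f v) hL0).trans ?_
    simp
  have hbad : #(T.filter fun p => ¬ good p) ≤ 5 * (n * L) := by
    have hsub : (T.filter fun p => ¬ good p) ⊆
        ({p : Fin n × Fin n | (p.2 : ℕ) / L = (p.1 : ℕ) / L} : Finset _) ∪
        (({p : Fin n × Fin n | (p.1 : ℕ) / L = (x : ℕ) / L} : Finset _) ∪
        (({p : Fin n × Fin n | (p.2 : ℕ) / L = (x : ℕ) / L} : Finset _) ∪
        (({p : Fin n × Fin n | (p.1 : ℕ) / L = (y : ℕ) / L} : Finset _) ∪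
        ({p : Fin n × Fin n | (p.2 : ℕ) / L = (y : ℕ) / L} : Finset _)))) := by
      intro p hp
      have hp' := (Finset.mem_filter.1 hp).2
      simp only [Finset.mem_union, Finset.mem_filter, Finset.mem_univ, true_and]
      by_contra hcon
      push Not at hcon
      exact hp' ⟨hcon.1.symm, hcon.2.1.symm, hcon.2.2.1.symm, hcon.2.2.2.1.symm,
        hcon.2.2.2.2.symm⟩
    have h0 := Finset.card_le_card hsub
    have h1 := hsnd fun v => (v : ℕ) / L
    have h2 := hfst ((x : ℕ) / L)
    have h3 := hsnd fun _ => (x : ℕ) / L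
    have h4 := hfst ((y : ℕ) / L)
    have h5 := hsnd fun _ => (y : ℕ) / L
    refine h0.trans ((Finset.card_union_le _ _).trans ?_)
    refine (Nat.add_le_add h1 ((Finset.card_union_le _ _).trans (Nat.add_le_add h2
      ((Finset.card_union_le _ _).trans (Nat.add_le_add h3
      ((Finset.card_union_le _ _).trans (Nat.add_le_add h4 h5))))))).trans ?_
    omega
  have hgoodcard : η / 2 * n ^ 2 ≤ (#(T.filter good) : ℝ) := by
    have h1 := Finset.card_filter_add_card_filter_not (s := T) good
    have h2 : (#T : ℝ) ≤ #(T.filter good) + 5 * (n * L) := by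
      have : #T ≤ #(T.filter good) + 5 * (n * L) := by omega
      exact_mod_cast this
    have h3 : (n : ℝ) * L ≤ n * (η / 10 * n) := by gcongr
    nlinarith
  obtain ⟨⟨I, J⟩, -, hIJ⟩ := Finset.exists_le_card_fiber_of_nsmul_le_card_of_maps_to
    (s := T.filter good) (t := Finset.range K ×ˢ Finset.range K)
    (f := fun p => ((p.1 : ℕ) / L, (p.2 : ℕ) / L)) (b := η / (2 * K ^ 2) * (n : ℝ) ^ 2)
    (fun p _ => by simp [hblk]) ⟨(0, 0), by simp [hK0]⟩ (by
      refine le_trans (le_of_eq ?_) hgoodcard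
      rw [nsmul_eq_mul, Finset.card_product, Finset.card_range]
      push_cast
      field_simp)
  have hpos : 0 < #{p ∈ T.filter good | ((p.1 : ℕ) / L, (p.2 : ℕ) / L) = (I, J)} := by
    have : (0 : ℝ) < η / (2 * K ^ 2) * (n : ℝ) ^ 2 := by positivity
    exact_mod_cast this.trans_le hIJ
  obtain ⟨p, hp⟩ := Finset.card_pos.1 hpos
  simp only [Finset.mem_filter, Prod.mk.injEq] at hp
  obtain ⟨⟨-, h1, h2, h3, h4, h5⟩, rfl, rfl⟩ := hp
  rcases lt_or_gt_of_ne h1 with hlt | hlt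
  · refine ⟨L, _, _, hlt, h2, h3, h4, h5, hIJ.trans ?_⟩
    refine Nat.cast_le.2 (Finset.card_le_card fun q hq => ?_)
    simp only [Finset.mem_filter, Prod.mk.injEq, hT, Finset.mem_univ, true_and] at hq ⊢
    exact ⟨hq.2.1, hq.2.2, hq.1.1⟩
  · refine ⟨L, _, _, hlt, h3, h2, h5, h4, hIJ.trans ?_⟩
    refine Nat.cast_le.2 (Finset.card_le_card_of_injOn Prod.swap ?_ Prod.swap_injective.injOn)
    intro q hq
    simp only [Finset.coe_filter, Finset.mem_filter, Prod.mk.injEq, hT, Finset.mem_univ,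
      true_and, Set.mem_ofPred_eq, Prod.fst_swap, Prod.snd_swap] at hq ⊢
    exact ⟨hq.2.2, hq.2.1, hq.1.1.symm⟩

theorem exists_adj_of_intervalChi_eq_two {h : ℕ} {H : SimpleGraph (Fin h)}
    (hchi : intervalChi H = 2) : ∃ a b : Fin h, a < b ∧ H.Adj a b := by
  by_contra hcon
  push Not at hcon
  have h1 : HasIntervalColoring H 1 := by
    refine ⟨fun _ => 0, fun _ _ _ => le_rfl, fun i j hij => ?_⟩
    rcases lt_trichotomy i j with hlt | rfl | hlt
    · exact absurd hij (hcon i j hlt)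
    · exact absurd hij (H.loopless.irrefl i)
    · exact absurd hij.symm (hcon j i hlt)
  have h2 : intervalChi H ≤ 1 := Nat.sInf_le h1
  omega

theorem connecting_lemma_isolated_ends (h : ℕ) (H : SimpleGraph (Fin h))
    (hchi : intervalChi H = 2)
    (hiso : ∀ a b : Fin h, H.Adj a b →
      (a : ℕ) + 1 ≠ 1 ∧ (a : ℕ) + 1 ≠ (h + 1) / 2 ∧ (a : ℕ) + 1 ≠ h)
    (hloc : ∀ a b : Fin h, H.Adj a b → (a : ℕ) < (b : ℕ) →
      2 ≤ (a : ℕ) + 1 ∧ (a : ℕ) + 1 ≤ (h + 1) / 2 - 1 ∧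
      (h + 1) / 2 + 1 ≤ (b : ℕ) + 1 ∧ (b : ℕ) + 1 ≤ h - 1)
    (η : ℝ) (hη0 : 0 < η) (hη1 : η < 1) :
    ∃ (n₀ : ℕ) (ξ : ℝ), 0 < ξ ∧ ∀ n : ℕ, n₀ ≤ n → ∀ G : SimpleGraph (Fin n),
      (∀ v : Fin n, η * n ≤ (odeg G v : ℝ)) →
      ∀ x y : Fin n,
        ξ * (n : ℝ) ^ (h - 1) ≤
          ({X : Finset (Fin n) | x ∉ X ∧ y ∉ X ∧ X.card = h - 1 ∧
            IsCopySet H G (insert x X) ∧ IsCopySet H G (insert y X)}.ncard : ℝ) := by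
  classical
  obtain ⟨a₀, b₀, hab₀, hadj₀⟩ := exists_adj_of_intervalChi_eq_two hchi
  have hab₁ := hloc a₀ b₀ hadj₀ hab₀
  obtain ⟨s, hs⟩ : ∃ s, s = (h + 1) / 2 - 1 := ⟨_, rfl⟩
  obtain ⟨t, ht⟩ : ∃ t, t = h - 1 - s := ⟨_, rfl⟩
  have hs0 : 0 < s := by omega
  have ht0 : 0 < t := by omega
  have hst : s + t = h - 1 := by omega
  have hk0 : 0 < h - 1 := by omega
  have hk : h - 1 + 1 = h := by omega
  have hloc' : ∀ a b : Fin h, H.Adj a b → a < b →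
      1 ≤ (a : ℕ) ∧ (a : ℕ) < s ∧ s < (b : ℕ) ∧ (b : ℕ) + 1 < h := by
    intro a b hab hlt
    have := hloc a b hab hlt
    omega
  have hcardα : Fintype.card (Fin s ⊕ Fin t) = h - 1 := by simp [hst]
  obtain ⟨n₁, c, hc, hblocks⟩ := exists_dense_blocks hη0
  clear hiso hloc hchi hab₁ ht hs
  generalize h - 1 = k at *
  have hδ : 0 < c ^ (s * t) := by positivity
  refine ⟨max n₁ ⌈2 * (k : ℝ) ^ 2 / c ^ (s * t)⌉₊, c ^ (s * t) / (2 * (k : ℝ) ^ k),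
    by positivity, ?_⟩
  intro n hn G hdeg x y
  obtain ⟨L, I, J, hIJ, hxI, hxJ, hyI, hyJ, hdense⟩ :=
    hblocks n (le_of_max_le_left hn) G hdeg x y
  have hnr : (0 : ℝ) < n := by exact_mod_cast x.pos
  have hn2 : 2 * (k : ℝ) ^ 2 ≤ c ^ (s * t) * n := by
    have := (Nat.le_ceil _).trans (Nat.cast_le.2 (le_of_max_le_right hn) :
      ((⌈2 * (k : ℝ) ^ 2 / c ^ (s * t)⌉₊ : ℕ) : ℝ) ≤ n)
    rw [div_le_iff₀ hδ] at this
    linarith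
  let R : Fin n → Fin n → Prop := fun a b => (a : ℕ) / L = I ∧ (b : ℕ) / L = J ∧ G.Adj a b
  obtain ⟨B, hBmem, hBcard⟩ : ∃ B : Finset (Fin s ⊕ Fin t → Fin n),
      (∀ F ∈ B, Function.Injective F ∧ ∀ i j, R (F (Sum.inl i)) (F (Sum.inr j))) ∧
      c ^ (s * t) / 2 * (n : ℝ) ^ k ≤ (#B : ℝ) := by
    have h1 := exists_many_injective_biclique_maps R (hst ▸ hk0) hc
      (by rwa [hst, Fintype.card_fin])
      (by
        rw [Fintype.card_fin]
        convert hdense)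
    rwa [Fintype.card_fin, hst] at h1
  have hfiber := card_le_mul_card_image_ranges B
  rw [hcardα] at hfiber
  have hcopy : ∀ F ∈ B, ∀ z : Fin n, (z : ℕ) / L ≠ I → (z : ℕ) / L ≠ J →
      z ∉ Finset.univ.image F ∧ IsCopySet H G (insert z (Finset.univ.image F)) := by
    intro F hF z hzI hzJ
    obtain ⟨hinj, hFR⟩ := hBmem F hF
    set P := Finset.univ.image fun i => F (Sum.inl i) with hPdef
    set Q := Finset.univ.image fun j => F (Sum.inr j) with hQdef
    have hPQ : Finset.univ.image F = P ∪ Q := by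
      ext v
      simp [hPdef, hQdef]
    have hPI : ∀ a ∈ P, (a : ℕ) / L = I := by
      intro a ha
      obtain ⟨i, -, rfl⟩ := Finset.mem_image.1 ha
      exact (hFR i ⟨0, ht0⟩).1
    have hQJ : ∀ b ∈ Q, (b : ℕ) / L = J := by
      intro b hb
      obtain ⟨j, -, rfl⟩ := Finset.mem_image.1 hb
      exact (hFR ⟨0, hs0⟩ j).2.1
    have hlt : ∀ v w : Fin n, (v : ℕ) / L < (w : ℕ) / L → v < w := fun v w hvw =>
      lt_of_not_ge fun hwv => hvw.not_ge (Nat.div_le_div_right hwv)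
    have hz : z ∉ Finset.univ.image F := by
      rw [hPQ, Finset.mem_union]
      rintro (hz | hz)
      · exact hzI (hPI z hz)
      · exact hzJ (hQJ z hz)
    refine ⟨hz, ?_⟩
    have hcard : #(insert z (Finset.univ.image F)) = h := by
      rw [Finset.card_insert_of_notMem hz, Finset.card_image_of_injective _ hinj,
        Finset.card_univ, hcardα, hk]
    rw [hPQ] at hcard ⊢
    refine isCopySet_insert_union hloc' ?_ hcard ?_ ?_ ?_
    · rw [hPdef, Finset.card_image_of_injective _ fun i j hij => Sum.inl_injective (hinj hij),
        Finset.card_univ, Fintype.card_fin]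
    · intro a ha b hb
      refine ⟨hlt a b (by rw [hPI a ha, hQJ b hb]; exact hIJ), ?_⟩
      obtain ⟨i, -, rfl⟩ := Finset.mem_image.1 ha
      obtain ⟨j, -, rfl⟩ := Finset.mem_image.1 hb
      exact (hFR i j).2.2
    · rcases lt_or_gt_of_ne hzI with hzI | hzI
      · exact Or.inl fun a ha => hlt _ _ (by rwa [hPI a ha])
      · exact Or.inr fun a ha => hlt _ _ (by rwa [hPI a ha])
    · rcases lt_or_gt_of_ne hzJ with hzJ | hzJ
      · exact Or.inl fun a ha => hlt _ _ (by rwa [hQJ a ha])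
      · exact Or.inr fun a ha => hlt _ _ (by rwa [hQJ a ha])
  have hsub : ((B.image fun F => Finset.univ.image F : Finset (Finset (Fin n))) :
      Set (Finset (Fin n))) ⊆ {X : Finset (Fin n) | x ∉ X ∧ y ∉ X ∧ X.card = k ∧
        IsCopySet H G (insert x X) ∧ IsCopySet H G (insert y X)} := by
    intro X hX
    obtain ⟨F, hF, rfl⟩ := Finset.mem_image.1 (Finset.mem_coe.1 hX)
    have hx := hcopy F hF x hxI hxJ
    have hy := hcopy F hF y hyI hyJ
    refine ⟨hx.1, hy.1, ?_, hx.2, hy.2⟩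
    rw [Finset.card_image_of_injective _ (hBmem F hF).1, Finset.card_univ, hcardα]
  have hle := Set.ncard_le_ncard hsub (Set.toFinite _)
  rw [Set.ncard_coe_finset] at hle
  have hkk : (0 : ℝ) < (k : ℝ) ^ k := by positivity
  have hfin : (#B : ℝ) ≤ (k : ℝ) ^ k *
      ({X : Finset (Fin n) | x ∉ X ∧ y ∉ X ∧ X.card = k ∧
        IsCopySet H G (insert x X) ∧ IsCopySet H G (insert y X)}.ncard : ℝ) := by
    exact_mod_cast hfiber.trans (Nat.mul_le_mul_left _ hle)
  rw [← mul_le_mul_iff_right₀ hkk]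
  refine le_trans (le_of_eq ?_) (hBcard.trans hfin)
  field_simp
end
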